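/- arXiv:1301.2690 — 6 statements merged into one kernel-verified Lean document; each statement's English description precedes it below -/
import Mathlib

section
/- Let f be a completely monotone function satisfying conditions (A-1), (A-2) and (A-3) (with parameters θ > 0, 0 ≤ Λ₁ < Λ₂ ≤ ∞, γ > 0). Then there exist constants c₂ > 0 and δ ∈ (0,1) such that ν(t) ≥ −c₂ t^{−2} f_e′(t^{−1} + ω₀) e^{ω₀ t} for all t ∈ (δΛ₂^{−1}, δΛ₁^{−1}), where ν(t) is the density of the representing measure of f. -/
open MeasureTheory Filter Set Topology

noncomputable section

/-- `f` is completely monotone on `(0,∞)`: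
it is `C^∞` there and `(-1)^n f^{(n)}(l) ≥ 0` for all `n ≥ 0`, `l > 0`. -/
def CompMono (f : ℝ → ℝ) : Prop :=
  ContDiffOn ℝ (⊤ : ℕ∞) f (Set.Ioi (0:ℝ)) ∧
  ∀ (n : ℕ) (l : ℝ), 0 < l → 0 ≤ (-1 : ℝ) ^ n * iteratedDeriv n f l

/-- `ν` is the representing measure of `f`: a measure on `[0,∞)`
with `f l = ∫ e^{-l t} ν(dt)` for all `l > 0`. -/
def IsRepMeasure (f : ℝ → ℝ) (ν : Measure ℝ) : Prop :=
  ν {t : ℝ | t < 0} = 0 ∧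
  ∀ l : ℝ, 0 < l →
    MeasureTheory.Integrable (fun t : ℝ => Real.exp (-(l * t))) ν ∧
    f l = ∫ t : ℝ, Real.exp (-(l * t)) ∂ν

/-- Condition (A-1): the measure `ν` has density `dens` (a positive function on `(0,∞)`)
with respect to Lebesgue measure. -/
def HasDensity (ν : Measure ℝ) (dens : ℝ → ℝ) : Prop :=
  (∀ t : ℝ, 0 < t → 0 < dens t) ∧
  ν = (volume.restrict (Set.Ioi (0:ℝ))).withDensity (fun t => ENNReal.ofReal (dens t))

/-- The right-limit `f^{(n)}(0+)` (junk value if it does not exist). -/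
def dplus (f : ℝ → ℝ) (n : ℕ) : ℝ :=
  limUnder (nhdsWithin 0 (Set.Ioi (0:ℝ))) (iteratedDeriv n f)

/-- All the right-limits `f^{(n)}(0+)` exist (as finite reals). -/
def DerivsFinite (f : ℝ → ℝ) : Prop :=
  ∀ n : ℕ, Filter.Tendsto (iteratedDeriv n f) (nhdsWithin 0 (Set.Ioi (0:ℝ))) (nhds (dplus f n))

/-- The terms of the series `∑ f^{(n)}(0+)/n! · (-l)^n`. -/
def tser (f : ℝ → ℝ) (l : ℝ) : ℕ → ℝ :=
  fun n => dplus f n / (n.factorial : ℝ) * (-l) ^ n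

/-- `ω` is the abscissa `ω₀` of `f`: if all `f^{(n)}(0+)` are finite then `ω` is the
infimum of the set where `∑ f^{(n)}(0+)/n! (-l)^n` converges, otherwise `ω = 0`.
(That a real `ω` satisfies this encodes `ω₀ > -∞`.) -/
def IsAbscissa (f : ℝ → ℝ) (ω : ℝ) : Prop :=
  (DerivsFinite f → IsGLB {l : ℝ | Summable (tser f l)} ω) ∧
  (¬ DerivsFinite f → ω = 0)

/-- `fe` is the extension `f_e` of `f` to `(ω,∞)`: it equals `f` on `(0,∞)` and the
series `∑ f^{(n)}(0+)/n! (-l)^n` on `(ω,0]`. -/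
def IsExtension (f fe : ℝ → ℝ) (ω : ℝ) : Prop :=
  (∀ l : ℝ, 0 < l → fe l = f l) ∧
  (∀ l : ℝ, ω < l → l ≤ 0 → fe l = ∑' n : ℕ, tser f l n)

/-- Condition (A-2) (monotonicity part): `t ↦ e^{-ω t} t⁻¹ dens t` is non-increasing on `(0,∞)`. -/
def CondA2 (dens : ℝ → ℝ) (ω : ℝ) : Prop :=
  ∀ s t : ℝ, 0 < s → s ≤ t →
    Real.exp (-(ω * t)) * t⁻¹ * dens t ≤ Real.exp (-(ω * s)) * s⁻¹ * dens s

/-- `φ` is a Bernstein function: nonnegative, `C^∞` on `(0,∞)` and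
`(-1)^{n-1} φ^{(n)} ≥ 0` for all `n ≥ 1`. -/
def Bernstein (φ : ℝ → ℝ) : Prop :=
  ContDiffOn ℝ (⊤ : ℕ∞) φ (Set.Ioi (0:ℝ)) ∧ (∀ l : ℝ, 0 < l → 0 ≤ φ l) ∧
  ∀ (n : ℕ) (l : ℝ), 0 < l → 0 ≤ (-1 : ℝ) ^ n * iteratedDeriv (n + 1) φ l

/-- `(a, b, μ)` is the Lévy triple of the Bernstein function `φ`:
`φ(l) = a + b l + ∫_{(0,∞)} (1 - e^{-l t}) μ(dt)` with `a, b ≥ 0` and `∫ (1 ∧ t) μ(dt) < ∞`. -/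
def HasLevyTriple (φ : ℝ → ℝ) (a b : ℝ) (μ : Measure ℝ) : Prop :=
  0 ≤ a ∧ 0 ≤ b ∧ μ {t : ℝ | t ≤ 0} = 0 ∧
  (∫⁻ t : ℝ, ENNReal.ofReal (min 1 t) ∂μ) < ⊤ ∧
  ∀ l : ℝ, 0 < l →
    MeasureTheory.Integrable (fun t : ℝ => 1 - Real.exp (-(l * t))) μ ∧
    φ l = a + b * l + ∫ t : ℝ, (1 - Real.exp (-(l * t))) ∂μ

/-- `h` is a complete Bernstein function: a Bernstein function whose Lévy measure
has a completely monotone density. -/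
def IsCBF (h : ℝ → ℝ) : Prop :=
  Bernstein h ∧ ∃ (a b : ℝ) (μ : Measure ℝ) (ρ : ℝ → ℝ),
    HasLevyTriple h a b μ ∧ CompMono ρ ∧ HasDensity μ ρ

end

lemma aux_contDiffAt {f : ℝ → ℝ} (hf : CompMono f) {x : ℝ} (hx : 0 < x) (n : ℕ) :
    ContDiffAt ℝ n f x :=
  (hf.1.contDiffAt (Ioi_mem_nhds hx)).of_le (by exact_mod_cast le_top)

lemma aux_differentiableAt {f : ℝ → ℝ} (hf : CompMono f) {x : ℝ} (hx : 0 < x) (n : ℕ) :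
    DifferentiableAt ℝ (iteratedDeriv n f) x :=
  by
  have h := (hf.1.differentiableOn_iteratedDerivWithin (m := n)
    (by exact_mod_cast ENat.natCast_lt_top n) (uniqueDiffOn_Ioi 0)).differentiableAt (Ioi_mem_nhds hx)
  refine h.congr_of_eventuallyEq ?_
  filter_upwards [Ioi_mem_nhds hx] with y hy
  exact (iteratedDerivWithin_of_isOpen isOpen_Ioi hy).symm

lemma aux_antitone {f : ℝ → ℝ} (hf : CompMono f) (n : ℕ) :
    AntitoneOn (fun x => (-1:ℝ)^n * iteratedDeriv n f x) (Ioi 0) := by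
  have hd : ∀ x ∈ Ioi (0:ℝ), HasDerivAt (fun x => (-1:ℝ)^n * iteratedDeriv n f x)
      ((-1:ℝ)^n * iteratedDeriv (n+1) f x) x := by
    intro x hx
    have := (aux_differentiableAt hf hx n).hasDerivAt.const_mul ((-1:ℝ)^n)
    rwa [← iteratedDeriv_succ] at this
  apply antitoneOn_of_deriv_nonpos (convex_Ioi 0)
  · exact fun x hx => (hd x hx).continuousAt.continuousWithinAt
  · rw [interior_Ioi]
    exact fun x hx => (hd x hx).differentiableAt.differentiableWithinAt
  · rw [interior_Ioi]
    intro x hx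
    rw [(hd x hx).deriv]
    have := hf.2 (n+1) x hx
    rw [pow_succ] at this
    linarith

lemma aux_abs_le {f : ℝ → ℝ} (hf : CompMono f) (hD : DerivsFinite f) (n : ℕ) {x : ℝ}
    (hx : 0 < x) : |iteratedDeriv n f x| ≤ |dplus f n| := by
  have h1 : (-1:ℝ)^n * iteratedDeriv n f x ≤ (-1:ℝ)^n * dplus f n := by
    refine ge_of_tendsto ((hD n).const_mul _) ?_
    filter_upwards [Ioo_mem_nhdsGT hx] with y hy
    exact aux_antitone hf n hy.1 hx hy.2.le
  have h2 := hf.2 n x hx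
  have h3 := abs_le_abs_of_nonneg h2 h1
  simpa [abs_mul] using h3

lemma aux_taylor {f : ℝ → ℝ} (hf : CompMono f) (hD : DerivsFinite f) (n : ℕ) {u : ℝ}
    (hu : 0 < u) :
    |f u - ∑ k ∈ Finset.range (n+1), dplus f k / (k.factorial : ℝ) * u ^ k| ≤
      |dplus f (n+1)| * u^(n+1) / ((n+1).factorial : ℝ) := by
  have hlim : Tendsto (fun e : ℝ => |f u - ∑ k ∈ Finset.range (n+1),
      iteratedDeriv k f e / (k.factorial : ℝ) * (u - e) ^ k|) (𝓝[>] 0)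
      (𝓝 |f u - ∑ k ∈ Finset.range (n+1), dplus f k / (k.factorial : ℝ) * u ^ k|) := by
    refine (tendsto_const_nhds.sub (tendsto_finsetSum _ fun k _ => ?_)).abs
    refine ((hD k).div_const _).mul ?_
    have : Tendsto (fun e : ℝ => (u - e)^k) (𝓝 0) (𝓝 ((u - 0)^k)) :=
      Continuous.tendsto (by fun_prop) 0
    rw [sub_zero] at this
    exact this.mono_left nhdsWithin_le_nhds
  refine le_of_tendsto hlim ?_
  filter_upwards [Ioo_mem_nhdsGT hu] with e he
  have hsub : ∀ y ∈ uIcc e u, 0 < y := by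
    intro y hy
    rw [uIcc_of_le he.2.le] at hy
    exact he.1.trans_le hy.1
  obtain ⟨y, hy, hyeq⟩ := taylor_mean_remainder_lagrange_iteratedDeriv (f := f) (x := u) (x₀ := e)
    (n := n) he.2.ne (fun y hy => by
      have := (aux_contDiffAt hf (hsub y hy) (n+1)).contDiffWithinAt (s := uIcc e u)
      exact_mod_cast this)
  have hsum : taylorWithinEval f n (uIcc e u) e u = ∑ k ∈ Finset.range (n+1),
      iteratedDeriv k f e / (k.factorial : ℝ) * (u - e) ^ k := by
    rw [taylor_within_apply]
    refine Finset.sum_congr rfl fun k _ => ?_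
    rw [iteratedDerivWithin_eq_iteratedDeriv (uniqueDiffOn_uIcc he.2.ne)
      (aux_contDiffAt hf he.1 k) left_mem_uIcc, smul_eq_mul]
    ring
  have hy0 : 0 < y := hsub y (uIoo_subset_uIcc_self hy)
  rw [← hsum, hyeq, abs_div, abs_mul, abs_of_pos (pow_pos (sub_pos.2 he.2) _), Nat.abs_cast]
  have := aux_abs_le hf hD (n+1) hy0
  have h2 : u - e ≤ u := by linarith [he.1]
  have h3 : 0 ≤ u - e := by linarith [he.2]
  gcongr

/-- The extension at a negative point is the reflected function. -/
lemma aux_fe_neg {f fe : ℝ → ℝ} {ω l : ℝ} (hf : CompMono f) (hD : DerivsFinite f)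
    (hω : IsAbscissa f ω) (hfe : IsExtension f fe ω) (hl : ω < l) (hl0 : l < 0) :
    fe l = f (-l) := by
  obtain ⟨s, hs, hsl⟩ : ∃ s ∈ {l : ℝ | Summable (tser f l)}, s < l := (isGLB_lt_iff (hω.1 hD)).1 hl
  have hs' : Summable (tser f s) := hs
  have hle : ∀ n, ‖tser f l n‖ ≤ ‖tser f s n‖ := by
    intro n
    simp only [tser, norm_mul, norm_pow, norm_neg]
    have : ‖l‖ ≤ ‖s‖ := by
      rw [Real.norm_eq_abs, Real.norm_eq_abs, abs_of_neg hl0, abs_of_neg (hsl.trans hl0)]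
      linarith
    gcongr
  have hsum : Summable (tser f l) := Summable.of_norm_bounded hs'.norm hle
  rw [hfe.2 l hl hl0.le]
  refine tendsto_nhds_unique (hsum.hasSum.tendsto_sum_nat.comp (tendsto_add_atTop_nat 1)) ?_
  rw [tendsto_iff_norm_sub_tendsto_zero]
  have h0 : Tendsto (fun n => ‖tser f l (n+1)‖) atTop (𝓝 0) := by
    have := (hsum.tendsto_atTop_zero.comp (tendsto_add_atTop_nat 1)).norm
    simpa using this
  refine squeeze_zero (fun _ => norm_nonneg _) (fun n => ?_) h0
  have h := aux_taylor hf hD n (u := -l) (by linarith)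
  rw [norm_sub_rev, Real.norm_eq_abs]
  refine (show _ ≤ _ from h).trans (le_of_eq ?_)
  simp only [tser, norm_mul, norm_div, norm_pow, Real.norm_eq_abs, Nat.abs_cast]
  rw [abs_of_pos (show 0 < -l by linarith)]
  ring

lemma aux_deriv_neg {f fe : ℝ → ℝ} {ω l : ℝ} (hf : CompMono f) (hD : DerivsFinite f)
    (hω : IsAbscissa f ω) (hfe : IsExtension f fe ω) (hl : ω < l) (hl0 : l < 0) :
    0 ≤ deriv fe l := by
  have h1 : fe =ᶠ[𝓝 l] fun x => f (-x) := by
    filter_upwards [Ioo_mem_nhds hl hl0] with x hx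
    exact aux_fe_neg hf hD hω hfe hx.1 hx.2
  rw [h1.deriv_eq, deriv_comp_neg]
  have := hf.2 1 (-l) (by linarith)
  simp only [iteratedDeriv_one, pow_one] at this
  linarith

lemma aux_deriv_zero {f fe : ℝ → ℝ} {ω : ℝ} (hf : CompMono f) (hD : DerivsFinite f)
    (hω : IsAbscissa f ω) (hfe : IsExtension f fe ω) (hω0 : ω < 0) :
    deriv fe 0 = 0 := by
  apply IsLocalMax.deriv_eq_zero
  have h0 : fe 0 = dplus f 0 := by
    rw [hfe.2 0 hω0 le_rfl, tsum_eq_single 0]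
    · simp [tser]
    · intro n hn
      simp [tser, hn]
  have hb : ∀ x, 0 < x → f x ≤ dplus f 0 := by
    intro x hx
    refine ge_of_tendsto (hD 0) ?_
    filter_upwards [Ioo_mem_nhdsGT hx] with y hy
    have := aux_antitone hf 0 (mem_Ioi.2 hy.1) (mem_Ioi.2 hx) hy.2.le
    simpa using this
  filter_upwards [Ioi_mem_nhds hω0] with x hx
  rw [h0]
  rcases lt_trichotomy x 0 with h | h | h
  · rw [aux_fe_neg hf hD hω hfe hx h]
    exact hb _ (by linarith)
  · rw [h, h0]
  · rw [hfe.1 x h]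
    exact hb _ h

lemma aux_deriv_pos {f fe : ℝ → ℝ} {ω l : ℝ} (hfe : IsExtension f fe ω) (hl : 0 < l) :
    deriv fe l = deriv f l := by
  apply Filter.EventuallyEq.deriv_eq
  filter_upwards [Ioi_mem_nhds hl] with x hx
  exact hfe.1 x hx

lemma aux_meas {dens : ℝ → ℝ} {ω : ℝ} (hA2 : CondA2 dens ω) :
    AEMeasurable dens (volume.restrict (Ioi (0:ℝ))) := by
  have h1 : AEMeasurable (fun t => Real.exp (-(ω * t)) * t⁻¹ * dens t)
      (volume.restrict (Ioi (0:ℝ))) :=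
    aemeasurable_restrict_of_antitoneOn measurableSet_Ioi (fun s hs t _ hst => hA2 s t hs hst)
  have h2 : AEMeasurable (fun t => (Real.exp (ω * t) * t) *
      (Real.exp (-(ω * t)) * t⁻¹ * dens t)) (volume.restrict (Ioi (0:ℝ))) :=
    AEMeasurable.mul (by fun_prop) h1
  refine h2.congr ?_
  filter_upwards [ae_restrict_mem measurableSet_Ioi] with t ht
  have ht' : t ≠ 0 := ne_of_gt ht
  rw [Real.exp_neg]
  field_simp

lemma aux_deriv_int {f dens : ℝ → ℝ} {ν : Measure ℝ} {ω : ℝ}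
    (hν : IsRepMeasure f ν) (hA1 : HasDensity ν dens) (hA2 : CondA2 dens ω) {a : ℝ} (ha : 0 < a) :
    IntegrableOn (fun s => dens s * (s * Real.exp (-(a * s)))) (Ioi 0) ∧
    deriv f a = - ∫ s in Ioi (0:ℝ), dens s * (s * Real.exp (-(a * s))) := by
  have hsub : Iio (0:ℝ) ⊆ ProbabilityTheory.integrableExpSet id ν := by
    intro v hv
    have := (hν.2 (-v) (by simpa using hv)).1
    simpa [ProbabilityTheory.integrableExpSet] using this
  have hmem : ∀ b : ℝ, 0 < b → -b ∈ interior (ProbabilityTheory.integrableExpSet id ν) := by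
    intro b hb
    exact interior_mono hsub (by rw [interior_Iio]; simpa using hb)
  have hm := aux_meas hA2
  have hm' : AEMeasurable (fun t => ENNReal.ofReal (dens t)) (volume.restrict (Ioi (0:ℝ))) :=
    hm.ennreal_ofReal
  have hinteg := ProbabilityTheory.integrable_pow_mul_exp_of_mem_interior_integrableExpSet (hmem a ha) 1
  have hder := ProbabilityTheory.hasDerivAt_mgf (hmem a ha)
  have heq : f =ᶠ[𝓝 a] fun x => ProbabilityTheory.mgf id ν (-x) := by
    filter_upwards [Ioi_mem_nhds ha] with x hx
    rw [(hν.2 x hx).2]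
    simp [ProbabilityTheory.mgf]
  have hd : deriv f a = - ∫ s, s * Real.exp (-a * s) ∂ν := by
    rw [heq.deriv_eq, deriv_comp_neg, hder.deriv]
    rfl
  have hfun : ∀ s ∈ Ioi (0:ℝ), (ENNReal.ofReal (dens s)).toReal • (s * Real.exp (-a * s)) =
      dens s * (s * Real.exp (-(a * s))) := by
    intro s hs
    rw [ENNReal.toReal_ofReal (hA1.1 s hs).le, smul_eq_mul, neg_mul]
  constructor
  · rw [hA1.2, integrable_withDensity_iff_integrable_smul₀' hm' (by simp)] at hinteg
    refine Integrable.congr hinteg ?_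
    filter_upwards [ae_restrict_mem measurableSet_Ioi] with s hs
    rw [← hfun s hs]
    simp
  · rw [hd, hA1.2, integral_withDensity_eq_integral_toReal_smul₀ hm' (by simp)]
    congr 1
    exact setIntegral_congr_fun measurableSet_Ioi hfun

lemma aux_gamma {l : ℝ} (hl : 0 < l) :
    IntegrableOn (fun s : ℝ => s^2 * Real.exp (-(l * s))) (Ioi 0) ∧
    ∫ s in Ioi (0:ℝ), s^2 * Real.exp (-(l * s)) = 2 / l^3 := by
  constructor
  · have := integrableOn_rpow_mul_exp_neg_mul_rpow (p := 1) (s := 2) (b := l) (by norm_num)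
      (by norm_num) hl
    simpa using this
  · have := Real.integral_rpow_mul_exp_neg_mul_Ioi (a := 3) (r := l) (by norm_num) hl
    have h3 : Real.Gamma 3 = 2 := by
      have := Real.Gamma_nat_eq_factorial 2
      rw [show (((2:ℕ):ℝ) + 1) = 3 by norm_num] at this
      rw [this]
      norm_num [Nat.factorial]
    rw [h3] at this
    have e : (3:ℝ) - 1 = ((2:ℕ):ℝ) := by norm_num
    have e3 : (3:ℝ) = ((3:ℕ):ℝ) := by norm_num
    rw [e] at this
    simp only [Real.rpow_natCast] at this
    rw [this, e3, Real.rpow_natCast]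
    field_simp

/-- The key estimate. -/
lemma aux_key {f dens : ℝ → ℝ} {ν : Measure ℝ} {ω : ℝ}
    (hν : IsRepMeasure f ν) (hA1 : HasDensity ν dens) (hA2 : CondA2 dens ω) {t l : ℝ} (ht : 0 < t)
    (hl : 0 < l) (hlt : l ≤ t⁻¹) (hlω : 0 < l + ω) :
    - deriv f (l + ω) ≤ Real.exp 1 * (- deriv f (t⁻¹ + ω)) +
      Real.exp (-(ω * t)) * t⁻¹ * dens t * (2 / l^3) ∧
    - deriv f (t⁻¹ + ω) ≤ - deriv f (l + ω) := by
  obtain ⟨i1, d1⟩ := aux_deriv_int hν hA1 hA2 hlω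
  obtain ⟨i2, d2⟩ := aux_deriv_int hν hA1 hA2 (show 0 < t⁻¹ + ω by linarith)
  obtain ⟨i3, d3⟩ := aux_gamma hl
  rw [d1, d2, neg_neg, neg_neg, ← d3]
  constructor
  · rw [← integral_const_mul, ← integral_const_mul,
      ← integral_add (i2.const_mul _) (i3.const_mul _)]
    refine setIntegral_mono_on i1 ((i2.const_mul _).add (i3.const_mul _)) measurableSet_Ioi ?_
    intro s hs
    have hs : 0 < s := hs
    have hds := hA1.1 s hs
    have hdt := hA1.1 t ht
    rcases le_total s t with h | h
    · have : Real.exp (-((l + ω) * s)) ≤ Real.exp 1 * Real.exp (-((t⁻¹ + ω) * s)) := by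
        rw [← Real.exp_add]
        apply Real.exp_le_exp.2
        have h1 : t⁻¹ * s ≤ 1 := by
          rw [inv_mul_le_iff₀ ht]; linarith
        nlinarith [mul_pos hl hs]
      have h2 : 0 ≤ Real.exp (-(ω * t)) * t⁻¹ * dens t * (s^2 * Real.exp (-(l * s))) := by
        positivity
      have h3 : dens s * (s * Real.exp (-((l + ω) * s))) ≤
          dens s * (s * (Real.exp 1 * Real.exp (-((t⁻¹ + ω) * s)))) := by gcongr
      linarith
    · have h2 : 0 ≤ Real.exp 1 * (dens s * (s * Real.exp (-((t⁻¹ + ω) * s)))) := by positivity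
      have h4 := hA2 t s ht h
      have h5 := mul_le_mul_of_nonneg_right h4
        (show 0 ≤ s^2 * Real.exp (-(l * s)) by positivity)
      have h6 : Real.exp (-(ω * s)) * s⁻¹ * dens s * (s^2 * Real.exp (-(l * s))) =
          dens s * (s * Real.exp (-((l + ω) * s))) := by
        rw [show -((l + ω) * s) = -(ω * s) + -(l * s) by ring, Real.exp_add]
        field_simp
      linarith
  · refine setIntegral_mono_on i2 i1 measurableSet_Ioi ?_
    intro s hs
    have hs : 0 < s := hs
    have hds := hA1.1 s hs
    gcongr

lemma aux_delta {θ γ : ℝ} (hγ : 0 < γ) :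
    ∃ δ : ℝ, 0 < δ ∧ δ < 1 ∧ Real.exp 1 * (θ * δ ^ γ) ≤ 1/2 := by
  have h : Tendsto (fun δ : ℝ => Real.exp 1 * (θ * δ ^ γ)) (𝓝[>] 0) (𝓝 0) := by
    have h1 : Tendsto (fun δ : ℝ => δ ^ γ) (𝓝 0) (𝓝 ((0:ℝ)^γ)) :=
      (Real.continuousAt_rpow_const 0 γ (Or.inr hγ.le)).tendsto
    rw [Real.zero_rpow hγ.ne'] at h1
    have := ((h1.const_mul θ).const_mul (Real.exp 1))
    simp only [mul_zero] at this
    exact this.mono_left nhdsWithin_le_nhds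
  have h2 := h.eventually (gt_mem_nhds (show (0:ℝ) < 1/2 by norm_num))
  obtain ⟨δ, h3, h4⟩ := (h2.and (Ioo_mem_nhdsGT (show (0:ℝ) < 1 by norm_num))).exists
  exact ⟨δ, h4.1, h4.2, h3.le⟩

/-- Constant for the bounded range when `ω < 0`. -/
lemma aux_const {f fe dens : ℝ → ℝ} {ν : Measure ℝ} {ω δ : ℝ} (hf : CompMono f)
    (hA1 : HasDensity ν dens)
    (hω : IsAbscissa f ω) (hfe : IsExtension f fe ω) (hA2 : CondA2 dens ω) (hδ : 0 < δ) :
    ∃ K : ℝ, 0 < K ∧ ∀ c t : ℝ, 0 < c → c ≤ K → 0 < t → δ / t + ω ≤ 0 →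
      -c * deriv fe (t⁻¹ + ω) * Real.exp (ω * t) / t ^ 2 ≤ dens t := by
  by_cases hω0 : ω < 0
  swap
  · refine ⟨1, one_pos, fun c t _ _ ht h => ?_⟩
    have : 0 < δ / t := by positivity
    linarith
  have hD : DerivsFinite f := by
    by_contra h
    exact hω0.ne (hω.2 h)
  set R := -ω with hR
  have hR0 : 0 < R := by linarith
  set G := Real.exp (-(ω * R⁻¹)) * (R⁻¹)⁻¹ * dens R⁻¹ with hG
  have hG0 : 0 < G := by
    have := hA1.1 R⁻¹ (by positivity)
    positivity
  refine ⟨(δ/R)^3 * G / (|dplus f 1| + 1), by positivity, fun c t hc hcK ht hδt => ?_⟩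
  have hdt := hA1.1 t ht
  rcases lt_trichotomy (t⁻¹ + ω) 0 with h | h | h
  · have h1 := aux_deriv_neg hf hD hω hfe (l := t⁻¹ + ω) (by have := inv_pos.2 ht; linarith) h
    have : 0 ≤ c * deriv fe (t⁻¹ + ω) * Real.exp (ω * t) / t ^ 2 := by positivity
    have e : -c * deriv fe (t⁻¹ + ω) * Real.exp (ω * t) / t ^ 2 =
      -(c * deriv fe (t⁻¹ + ω) * Real.exp (ω * t) / t ^ 2) := by ring
    linarith
  · rw [h, aux_deriv_zero hf hD hω hfe hω0]
    simpa using hdt.le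
  · rw [aux_deriv_pos hfe h]
    have hM := aux_abs_le hf hD 1 h
    rw [iteratedDeriv_one] at hM
    have hM2 : -deriv f (t⁻¹ + ω) ≤ |dplus f 1| + 1 := by
      linarith [neg_le_abs (deriv f (t⁻¹ + ω))]
    have htR : t ≤ R⁻¹ := by
      rw [le_inv_comm₀ ht hR0]; linarith
    have hg := hA2 t R⁻¹ ht htR
    rw [← hG] at hg
    have hδR : δ / R ≤ t := by
      rw [div_le_iff₀ hR0]
      have : δ / t ≤ R := by linarith
      rw [div_le_iff₀ ht] at this
      linarith
    have h1 : c * (|dplus f 1| + 1) ≤ (δ/R)^3 * G := by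
      rwa [le_div_iff₀ (by positivity)] at hcK
    have h2 : (δ/R)^3 * G ≤ t^3 * G := by gcongr
    have h3 : c * (-deriv f (t⁻¹ + ω)) ≤ c * (|dplus f 1| + 1) := by gcongr
    have h4 : t^3 * G ≤ t^3 * (Real.exp (-(ω * t)) * t⁻¹ * dens t) := by gcongr
    have h5 : t^3 * (Real.exp (-(ω * t)) * t⁻¹ * dens t) * Real.exp (ω * t) = dens t * t^2 := by
      rw [Real.exp_neg]
      field_simp
    rw [div_le_iff₀ (by positivity), ← h5]
    have h6 : -c * deriv f (t⁻¹ + ω) ≤ t^3 * (Real.exp (-(ω * t)) * t⁻¹ * dens t) := by linarith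
    gcongr

/-- Theorem 1.4(ii): under (A-1), (A-2) and (A-3),
`ν(t) ≥ -c₂ t^{-2} f_e'(t⁻¹ + ω₀) e^{ω₀ t}` for all `t ∈ (δ Λ₂⁻¹, δ Λ₁⁻¹)`. -/
theorem stmt_1 (f fe dens : ℝ → ℝ) (ν : MeasureTheory.Measure ℝ) (ω₀ θ γ : ℝ)
    (Λ₁ Λ₂ : ENNReal)
    (hf : CompMono f) (hν : IsRepMeasure f ν) (hA1 : HasDensity ν dens)
    (hω : IsAbscissa f ω₀) (hfe : IsExtension f fe ω₀) (hA2 : CondA2 dens ω₀)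
    (hθ : 0 < θ) (hγ : 0 < γ) (hΛ : Λ₁ < Λ₂)
    (hA3 : ∀ x l : ℝ, 1 ≤ x → Λ₁ < ENNReal.ofReal l → ENNReal.ofReal l < Λ₂ →
      deriv fe (l * x + ω₀) / deriv fe (l + ω₀) ≤ θ * x ^ (-γ)) :
    ∃ c₂ δ : ℝ, 0 < c₂ ∧ 0 < δ ∧ δ < 1 ∧ ∀ t : ℝ,
      ENNReal.ofReal δ * Λ₂⁻¹ < ENNReal.ofReal t →
      ENNReal.ofReal t < ENNReal.ofReal δ * Λ₁⁻¹ →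
      -c₂ * deriv fe (t⁻¹ + ω₀) * Real.exp (ω₀ * t) / t ^ 2 ≤ dens t := by
  obtain ⟨δ, hδ0, hδ1, hδ⟩ := aux_delta (θ := θ) hγ
  obtain ⟨K, hK0, hK⟩ := aux_const hf hA1 hω hfe hA2 hδ0
  refine ⟨min K (δ^3/4), δ, by positivity, hδ0, hδ1, fun t h1 h2 => ?_⟩
  have ht : 0 < t := ENNReal.ofReal_pos.1 (lt_of_le_of_lt zero_le h1)
  rcases le_or_gt (δ / t + ω₀) 0 with hc | hc
  · exact hK _ t (by positivity) (min_le_left _ _) ht hc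
  have hl : 0 < δ / t := by positivity
  have hlt : δ / t ≤ t⁻¹ := by
    rw [div_eq_mul_inv]
    have := inv_pos.2 ht
    nlinarith
  have htω : 0 < t⁻¹ + ω₀ := by linarith
  have htop : ENNReal.ofReal t ≠ ⊤ := ENNReal.ofReal_ne_top
  have ht0 : ENNReal.ofReal t ≠ 0 := (ENNReal.ofReal_pos.2 ht).ne'
  have hd0 : ENNReal.ofReal δ ≠ 0 := (ENNReal.ofReal_pos.2 hδ0).ne'
  have hdiv : ENNReal.ofReal (δ / t) = ENNReal.ofReal δ / ENNReal.ofReal t :=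
    ENNReal.ofReal_div_of_pos ht
  have hL1 : Λ₁ < ENNReal.ofReal (δ / t) := by
    rw [hdiv]
    rw [← div_eq_mul_inv] at h2
    rw [ENNReal.lt_div_iff_mul_lt (Or.inl ht0) (Or.inl htop)]
    rw [ENNReal.lt_div_iff_mul_lt (Or.inr htop) (Or.inr ht0)] at h2
    rwa [mul_comm]
  have hL2 : ENNReal.ofReal (δ / t) < Λ₂ := by
    rw [hdiv]
    rw [← div_eq_mul_inv] at h1
    rw [ENNReal.div_lt_iff (Or.inl ht0) (Or.inl htop)]
    rw [ENNReal.div_lt_iff (Or.inr hd0) (Or.inr ENNReal.ofReal_ne_top)] at h1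
    rwa [mul_comm]
  have hA := hA3 δ⁻¹ (δ / t) ((one_le_inv₀ hδ0).2 hδ1.le) hL1 hL2
  have e1 : δ / t * δ⁻¹ + ω₀ = t⁻¹ + ω₀ := by field_simp
  have e2 : (δ⁻¹) ^ (-γ) = δ ^ γ := by
    rw [Real.rpow_neg (by positivity), Real.inv_rpow hδ0.le, inv_inv]
  rw [e1, e2, aux_deriv_pos hfe htω, aux_deriv_pos hfe hc] at hA
  rw [aux_deriv_pos hfe htω]
  obtain ⟨k1, k2⟩ := aux_key hν hA1 hA2 ht hl hlt hc
  have n1 : 0 ≤ - deriv f (t⁻¹ + ω₀) := by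
    have := hf.2 1 _ htω
    simpa using this
  have hdt := hA1.1 t ht
  generalize hp : - deriv f (t⁻¹ + ω₀) = p at *
  generalize hq : - deriv f (δ / t + ω₀) = q at *
  have hp' : deriv f (t⁻¹ + ω₀) = -p := by linarith
  have hq' : deriv f (δ / t + ω₀) = -q := by linarith
  rw [hp', hq', neg_div_neg_eq] at hA
  rw [hp']
  have hpq : p ≤ θ * δ ^ γ * q := by
    rcases (n1.trans k2).eq_or_lt with h | h
    · rw [← h] at k2 ⊢
      linarith
    · rwa [div_le_iff₀ h] at hA
  have hep : Real.exp 1 * p ≤ 1/2 * q := by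
    calc Real.exp 1 * p ≤ Real.exp 1 * (θ * δ ^ γ * q) := by gcongr
      _ = Real.exp 1 * (θ * δ ^ γ) * q := by ring
      _ ≤ 1/2 * q := by
        have := n1.trans k2
        gcongr
  have hfin : p ≤ Real.exp (-(ω₀ * t)) * t⁻¹ * dens t * (4 / (δ / t)^3) := by
    have e : Real.exp (-(ω₀ * t)) * t⁻¹ * dens t * (4 / (δ / t)^3) =
      2 * (Real.exp (-(ω₀ * t)) * t⁻¹ * dens t * (2 / (δ / t)^3)) := by ring
    rw [e]
    linarith
  have hc2 : min K (δ^3/4) * p ≤ δ^3/4 * p := by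
    gcongr
    exact min_le_right _ _
  have h7 : δ^3/4 * p ≤ Real.exp (-(ω₀ * t)) * t^2 * dens t := by
    calc δ^3/4 * p ≤ δ^3/4 * (Real.exp (-(ω₀ * t)) * t⁻¹ * dens t * (4 / (δ / t)^3)) := by gcongr
      _ = _ := by field_simp
  rw [div_le_iff₀ (by positivity)]
  have h8 : Real.exp (-(ω₀ * t)) * t^2 * dens t * Real.exp (ω₀ * t) = dens t * t^2 := by
    rw [Real.exp_neg]
    field_simp
  rw [← h8]
  have h9 : -min K (δ^3/4) * -p ≤ Real.exp (-(ω₀ * t)) * t^2 * dens t := by linarith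
  gcongr
end

section
/- Let f be a completely monotone function satisfying condition (A-1). Then for every ω < ω₀ one has limsup_{t→∞} ν(t)/e^{ω t} = +∞, where ν(t) is the density of the representing measure of f. -/
open MeasureTheory Filter Set Topology

/-- Theorem 1.4(iii): under (A-1), for every `ω < ω₀`,
`limsup_{t → ∞} ν(t)/e^{ω t} = +∞`. -/
theorem stmt_2 (f dens : ℝ → ℝ) (ν : MeasureTheory.Measure ℝ) (ω₀ : ℝ)
    (hf : CompMono f) (hν : IsRepMeasure f ν) (hA1 : HasDensity ν dens)
    (hω : IsAbscissa f ω₀) :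
    ∀ ω : ℝ, ω < ω₀ →
      Filter.limsup (fun t : ℝ => ((dens t / Real.exp (ω * t) : ℝ) : EReal))
        Filter.atTop = ⊤ := by
  intro ω hlt
  by_contra hne
  obtain ⟨hpos, hdens⟩ := hA1
  obtain ⟨hneg, hrep⟩ := hν
  -- eventual exponential bound
  have hB : ∃ C T : ℝ, 0 ≤ T ∧ ∀ t, T < t → dens t ≤ C * Real.exp (ω * t) := by
    have h1 := lt_top_iff_ne_top.2 hne
    obtain ⟨C, hC1, hC2⟩ := EReal.lt_iff_exists_real_btwn.1 h1
    have h2 := Filter.eventually_lt_of_limsup_lt hC1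
    obtain ⟨T, hT⟩ := Filter.eventually_atTop.1 h2
    refine ⟨C, max T 0, le_max_right _ _, fun t ht => ?_⟩
    have h3 := hT t ((le_max_left _ _).trans ht.le)
    have h4 : dens t / Real.exp (ω * t) < C := by exact_mod_cast h3
    rw [div_lt_iff₀ (Real.exp_pos _)] at h4
    exact h4.le
  obtain ⟨C, T, hT0, hB⟩ := hB
  have hae : ∀ᵐ t ∂ν, 0 ≤ t := by
    rw [ae_iff]; simpa using hneg
  -- integrability
  have hint : ∀ l : ℝ, ω < l → Integrable (fun t : ℝ => Real.exp (l * (-t))) ν := by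
    intro l hl
    have hmeas : Measurable (fun t : ℝ => Real.exp (l * (-t))) := by fun_prop
    rw [← integrableOn_univ, ← Set.Iic_union_Ioi (a := T)]
    refine IntegrableOn.union ?_ ?_
    · have h1 := ((hrep 1 one_pos).1.const_mul (Real.exp (|l - 1| * T))).integrableOn
        (s := Set.Iic T)
      refine Integrable.mono' h1 hmeas.aestronglyMeasurable ?_
      filter_upwards [ae_restrict_of_ae hae, ae_restrict_mem measurableSet_Iic] with t ht htT
      rw [Real.norm_eq_abs, abs_of_pos (Real.exp_pos _), ← Real.exp_add]
      apply Real.exp_le_exp.2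
      have h2 : -(l - 1) * t ≤ |l - 1| * t :=
        mul_le_mul_of_nonneg_right (neg_le_abs _) ht
      have h3 : |l - 1| * t ≤ |l - 1| * T :=
        mul_le_mul_of_nonneg_left htT (abs_nonneg _)
      linarith
    · have hle : ν.restrict (Set.Ioi T) ≤ (volume.restrict (Set.Ioi T)).withDensity
          (fun t => ENNReal.ofReal (C * Real.exp (ω * t))) := by
        rw [hdens, restrict_withDensity measurableSet_Ioi,
          Measure.restrict_restrict measurableSet_Ioi,
          Set.inter_eq_left.2 (Set.Ioi_subset_Ioi hT0)]
        apply withDensity_mono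
        filter_upwards [ae_restrict_mem measurableSet_Ioi] with t ht
        exact ENNReal.ofReal_le_ofReal (hB t ht)
      refine Integrable.mono_measure ?_ hle
      rw [integrable_withDensity_iff (by fun_prop) (by simp)]
      have h1 := (integrableOn_exp_mul_Ioi (a := ω - l) (by linarith) T).const_mul C
      refine h1.congr ?_
      filter_upwards [ae_restrict_mem measurableSet_Ioi] with t ht
      have hp := (hpos t (hT0.trans_lt ht)).le.trans (hB t ht)
      rw [ENNReal.toReal_ofReal hp, mul_left_comm, ← Real.exp_add]
      ring_nf
  set X : ℝ → ℝ := fun t => -t with hX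
  have hsub : Set.Ioi ω ⊆ interior (ProbabilityTheory.integrableExpSet X ν) :=
    interior_maximal (fun l hl => hint l hl) isOpen_Ioi
  have heq : ∀ l : ℝ, 0 < l → f l = ProbabilityTheory.mgf X ν l := by
    intro l hl
    rw [(hrep l hl).2]
    simp [ProbabilityTheory.mgf, hX]
  -- the key consequence when `ω < 0`
  have key : ω < 0 → ∀ n, Tendsto (iteratedDeriv n f) (𝓝[>] 0) (𝓝 (∫ t, X t ^ n ∂ν)) := by
    intro h0 n
    have hz := hsub h0
    have hc : ContinuousAt (iteratedDeriv n (ProbabilityTheory.mgf X ν)) 0 := by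
      rw [iteratedDeriv_eq_iterate]
      exact ((ProbabilityTheory.analyticAt_mgf hz).iterated_deriv n).continuousAt
    have h1 := hc.tendsto
    rw [ProbabilityTheory.iteratedDeriv_mgf_zero hz] at h1
    refine (h1.mono_left nhdsWithin_le_nhds).congr' ?_
    filter_upwards [self_mem_nhdsWithin] with l hl
    refine (Filter.EventuallyEq.iteratedDeriv_eq n ?_).symm
    filter_upwards [Ioi_mem_nhds hl] with x hx
    exact heq x hx
  have key2 : ω < 0 → ∀ n, dplus f n = ∫ t, X t ^ n ∂ν := fun h0 n => (key h0 n).limUnder_eq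
  have hsum0 : Summable (tser f 0) := by
    refine summable_of_ne_finset_zero (s := {0}) fun n hn => ?_
    have : n ≠ 0 := by simpa using hn
    simp [tser, this]
  have hω0 : ω₀ ≤ 0 := by
    by_cases h : DerivsFinite f
    · exact (hω.1 h).1 hsum0
    · exact (hω.2 h).le
  have h0 : ω < 0 := hlt.trans_le hω0
  have hfin : DerivsFinite f := fun n => by rw [key2 h0 n]; exact key h0 n
  obtain ⟨l, hl1, hl2⟩ := exists_between hlt
  have hl0 : l < 0 := hl2.trans_le hω0
  have hmom := fun n => ProbabilityTheory.integrable_pow_of_mem_interior_integrableExpSet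
    (hsub h0) n
  have hterm : ∀ n, (-1) ^ n * tser f l n = ∫ t, (l * X t) ^ n / (n.factorial : ℝ) ∂ν := by
    intro n
    have : ∀ t, (l * X t) ^ n / (n.factorial : ℝ) = l ^ n / (n.factorial : ℝ) * X t ^ n := by
      intro t; rw [mul_pow]; ring
    simp_rw [this]
    rw [integral_const_mul, tser, key2 h0]
    have h2 : (-l) ^ n = (-1) ^ n * l ^ n := by rw [← mul_pow]; ring
    have h3 : ((-1 : ℝ) ^ n) * (-1) ^ n = 1 := by rw [← mul_pow]; simp
    rw [h2]
    linear_combination (∫ t, X t ^ n ∂ν) / (n.factorial : ℝ) * l ^ n * h3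
  have hs' : Summable (fun n => (-1) ^ n * tser f l n) := by
    refine summable_of_sum_range_le (c := ∫ t, Real.exp (l * X t) ∂ν) ?_ ?_
    · intro n
      rw [hterm]
      apply integral_nonneg_of_ae
      filter_upwards [hae] with t ht
      have : 0 ≤ l * X t := by simp only [hX]; nlinarith
      simp only [Pi.zero_apply]
      positivity
    · intro n
      simp_rw [hterm]
      have hi : ∀ i, Integrable (fun t => (l * X t) ^ i / (i.factorial : ℝ)) ν := by
        intro i
        simp_rw [mul_pow]
        exact ((hmom i).const_mul _).div_const _
      rw [← integral_finsetSum _ (fun i _ => hi i)]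
      refine integral_mono_ae (integrable_finsetSum _ (fun i _ => hi i)) (hint l hl1) ?_
      filter_upwards [hae] with t ht
      exact Real.sum_le_exp_of_nonneg (by simp only [hX]; nlinarith) n
  have hs : Summable (tser f l) := by
    refine Summable.of_norm ?_
    simpa [abs_mul] using hs'.norm
  exact absurd ((hω.1 hfin).1 hs) (not_le.2 hl2)
end

section
/- Let f be a completely monotone function such that f′ varies regularly at the origin with index −ρ−1 for some 0 ≤ ρ ≤ 1, and assume the representing measure of f has a non-increasing density ν(t). Then there exist constants 0 < c₁ ≤ c₂ such that c₁ (−t^{−2} f′(t^{−1})) ≤ ν(t) ≤ c₂ (−t^{−2} f′(t^{−1})) for all t > 1. -/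
open MeasureTheory Filter Set Topology

theorem g_formula (f dens : ℝ → ℝ) (ν : MeasureTheory.Measure ℝ)
    (hν : IsRepMeasure f ν) (hA1 : HasDensity ν dens)
    (hmono : ∀ s t : ℝ, 0 < s → s ≤ t → dens t ≤ dens s) (l : ℝ) (hl : 0 < l) :
    IntegrableOn (fun s => s * Real.exp (-(l * s)) * dens s) (Ioi 0) ∧
    -deriv f l = ∫ s in Ioi (0:ℝ), s * Real.exp (-(l * s)) * dens s := by
  have hmeas : AEMeasurable dens (volume.restrict (Ioi (0:ℝ))) :=
    aemeasurable_restrict_of_antitoneOn measurableSet_Ioi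
      (fun s hs t _ hst => hmono s t hs hst)
  have hsub : Iio (0:ℝ) ⊆ ProbabilityTheory.integrableExpSet id ν := by
    intro x hx
    have := (hν.2 (-x) (by simpa using hx)).1
    simpa [ProbabilityTheory.integrableExpSet] using this
  have hmem : -l ∈ interior (ProbabilityTheory.integrableExpSet id ν) :=
    interior_mono hsub (by simpa [interior_Iio] using hl)
  have hI : Integrable (fun s => s * Real.exp (-(l * s))) ν := by
    have := ProbabilityTheory.integrable_pow_mul_exp_of_mem_interior_integrableExpSet hmem 1
    simpa using this
  have hD : HasDerivAt f (-∫ s, s * Real.exp (-(l * s)) ∂ν) l := by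
    have h1 := ProbabilityTheory.hasDerivAt_mgf hmem
    have h2 : HasDerivAt (fun x : ℝ => -x) (-1) l := hasDerivAt_neg l
    have h3 := h1.comp l h2
    have h4 : f =ᶠ[𝓝 l] (ProbabilityTheory.mgf id ν ∘ fun x : ℝ => -x) := by
      filter_upwards [Ioi_mem_nhds hl] with x hx
      rw [(hν.2 x hx).2]
      simp [ProbabilityTheory.mgf]
    have h5 := h3.congr_of_eventuallyEq h4
    simpa using h5
  have hae : ∀ᵐ s ∂(volume.restrict (Ioi (0:ℝ))),
      (ENNReal.ofReal (dens s)).toReal • (s * Real.exp (-(l * s)))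
        = s * Real.exp (-(l * s)) * dens s := by
    filter_upwards [ae_restrict_mem measurableSet_Ioi] with s hs
    rw [ENNReal.toReal_ofReal (hA1.1 s hs).le, smul_eq_mul, mul_comm]
  rw [hD.deriv, neg_neg]
  rw [hA1.2] at hI ⊢
  constructor
  · rw [integrable_withDensity_iff_integrable_smul₀' hmeas.ennreal_ofReal
      (Eventually.of_forall fun _ => ENNReal.ofReal_lt_top)] at hI
    exact hI.congr hae
  · rw [integral_withDensity_eq_integral_toReal_smul₀ hmeas.ennreal_ofReal
      (Eventually.of_forall fun _ => ENNReal.ofReal_lt_top)]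
    exact integral_congr_ae hae

/-- Corollary 1.7 (regular variation at the origin): if `-f'` varies regularly at the origin
with index `-ρ-1` (`0 ≤ ρ ≤ 1`) and the representing measure has a non-increasing density
`dens`, then `dens t ≍ -t^{-2} f'(t⁻¹)` on `(1,∞)`. -/
theorem stmt_4 (f dens : ℝ → ℝ) (ν : MeasureTheory.Measure ℝ) (ρ : ℝ)
    (hf : CompMono f) (hν : IsRepMeasure f ν) (hA1 : HasDensity ν dens)
    (hmono : ∀ s t : ℝ, 0 < s → s ≤ t → dens t ≤ dens s)
    (hρ0 : 0 ≤ ρ) (hρ1 : ρ ≤ 1)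
    (hpos : ∀ l : ℝ, 0 < l → deriv f l < 0)
    (hreg : ∀ x : ℝ, 0 < x →
      Filter.Tendsto (fun l : ℝ => (-deriv f (l * x)) / (-deriv f l))
        (nhdsWithin 0 (Set.Ioi (0:ℝ))) (nhds (x ^ (-ρ - 1)))) :
    ∃ c₁ c₂ : ℝ, 0 < c₁ ∧ c₁ ≤ c₂ ∧ ∀ t : ℝ, 1 < t →
      c₁ * (-(deriv f t⁻¹) / t ^ 2) ≤ dens t ∧
      dens t ≤ c₂ * (-(deriv f t⁻¹) / t ^ 2) := by
  set g : ℝ → ℝ := fun l => ∫ s in Ioi (0:ℝ), s * Real.exp (-(l * s)) * dens s with hg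
  have hF := g_formula f dens ν hν hA1 hmono
  have hgd : ∀ l, 0 < l → -deriv f l = g l := fun l hl => (hF l hl).2
  have hI : ∀ l, 0 < l → IntegrableOn (fun s => s * Real.exp (-(l * s)) * dens s) (Ioi 0) :=
    fun l hl => (hF l hl).1
  have hgpos : ∀ l, 0 < l → 0 < g l := fun l hl => by
    rw [← hgd l hl]; linarith [hpos l hl]
  have hup : ∀ t, 0 < t → dens t ≤ 4 * Real.exp 1 * (g t⁻¹ / t ^ 2) := by
    intro t ht
    have hsub : Ioc (t/2) t ⊆ Ioi 0 := fun s hs => lt_trans (by positivity) hs.1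
    have h1 : ∫ s in Ioc (t/2) t, t / 2 * Real.exp (-1) * dens t ≤
        ∫ s in Ioc (t/2) t, s * Real.exp (-(t⁻¹ * s)) * dens s := by
      apply setIntegral_mono_on (integrableOn_const measure_Ioc_lt_top.ne) ((hI _ (inv_pos.2 ht)).mono_set hsub) measurableSet_Ioc
      intro s hs
      have hs0 : 0 < s := hsub hs
      have hd := hmono s t hs0 hs.2
      have hd0 := hA1.1 t ht
      have : t⁻¹ * s ≤ 1 := by
        rw [inv_mul_le_iff₀ ht]; linarith [hs.2]
      have h2 := hs.1.le
      gcongr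
    have h2 : ∫ s in Ioc (t/2) t, s * Real.exp (-(t⁻¹ * s)) * dens s ≤ g t⁻¹ := by
      apply setIntegral_mono_set (hI _ (inv_pos.2 ht)) _ hsub.eventuallyLE
      filter_upwards [ae_restrict_mem measurableSet_Ioi] with s hs
      have hs0 : 0 < s := hs
      have := hA1.1 s hs
      simp only [Pi.zero_apply]
      positivity
    have h3 : (t/2) * (t / 2 * Real.exp (-1) * dens t) ≤ g t⁻¹ := by
      refine le_trans (le_of_eq ?_) (h1.trans h2)
      rw [setIntegral_const, smul_eq_mul, Real.volume_real_Ioc_of_le (by linarith)]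
      ring
    rw [Real.exp_neg] at h3
    have he := Real.exp_pos 1
    rw [← mul_div_assoc, le_div_iff₀ (by positivity)]
    calc dens t * t ^ 2 = 4 * Real.exp 1 * ((t/2) * (t / 2 * (Real.exp 1)⁻¹ * dens t)) := by
          field_simp; ring
      _ ≤ _ := by gcongr
  have hlow : ∀ t, 0 < t → g (t⁻¹ * (1/8)) ≤ Real.exp 1 * g t⁻¹ + 64 * t ^ 2 * dens t := by
    intro t ht
    have hk : 0 < t⁻¹ * (1/8) := by positivity
    have hJ : ∫ s in Ioi (0:ℝ), s * Real.exp (-(t⁻¹ * (1/8) * s)) = 64 * t ^ 2 := by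
      have := Real.integral_rpow_mul_exp_neg_mul_Ioi (a := 2) (by norm_num) hk
      rw [show (2:ℝ) - 1 = 1 by norm_num] at this
      simp only [Real.rpow_one] at this
      rw [this, Real.Gamma_two, Real.rpow_two]
      field_simp; norm_num
    have hJI : IntegrableOn (fun s : ℝ => s * Real.exp (-(t⁻¹ * (1/8) * s))) (Ioi 0) := by
      by_contra hc
      have := integral_undef hc
      rw [hJ] at this
      have : 0 < t ^ 2 := by positivity
      linarith
    have h1 : g (t⁻¹ * (1/8)) ≤ ∫ s in Ioi (0:ℝ), (Real.exp 1 * (s * Real.exp (-(t⁻¹ * s)) * dens s)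
        + dens t * (s * Real.exp (-(t⁻¹ * (1/8) * s)))) := by
      apply setIntegral_mono_on (hI _ hk)
        (((hI _ (inv_pos.2 ht)).const_mul _).add (hJI.const_mul _)) measurableSet_Ioi
      intro s hs
      have hs0 : 0 < s := hs
      have hds := hA1.1 s hs
      have hdt := hA1.1 t ht
      rcases le_total s t with hst | hst
      · have h2 : 1 ≤ Real.exp 1 * Real.exp (-(t⁻¹ * s)) := by
          rw [← Real.exp_add, Real.one_le_exp_iff]
          have : t⁻¹ * s ≤ 1 := by
            rw [inv_mul_le_iff₀ ht]; linarith
          linarith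
        have h3 : Real.exp (-(t⁻¹ * (1/8) * s)) ≤ 1 := by
          rw [Real.exp_le_one_iff]
          have : 0 < t⁻¹ * (1/8) * s := by positivity
          linarith
        have h4 : 0 ≤ dens t * (s * Real.exp (-(t⁻¹ * (1/8) * s))) := by positivity
        calc s * Real.exp (-(t⁻¹ * (1/8) * s)) * dens s ≤ s * 1 * dens s := by gcongr
          _ ≤ s * (Real.exp 1 * Real.exp (-(t⁻¹ * s))) * dens s := by gcongr
          _ ≤ _ := by simp only [Pi.add_apply]; linarith
      · have h2 := hmono t s ht hst
        have h4 : 0 ≤ Real.exp 1 * (s * Real.exp (-(t⁻¹ * s)) * dens s) := by positivity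
        calc s * Real.exp (-(t⁻¹ * (1/8) * s)) * dens s
            ≤ s * Real.exp (-(t⁻¹ * (1/8) * s)) * dens t := by gcongr
          _ ≤ _ := by simp only [Pi.add_apply]; linarith
    refine h1.trans (le_of_eq ?_)
    rw [integral_add ((hI _ (inv_pos.2 ht)).const_mul _) (hJI.const_mul _),
      integral_const_mul, integral_const_mul, hJ]
    ring
  have hanti : ∀ a b, 0 < a → a ≤ b → g b ≤ g a := by
    intro a b ha hab
    apply setIntegral_mono_on (hI _ (ha.trans_le hab)) (hI _ ha) measurableSet_Ioi
    intro s hs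
    have hs0 : 0 < s := hs
    have hds := hA1.1 s hs
    gcongr
  have hev : ∀ᶠ l in 𝓝[>] (0:ℝ), 7 * g l ≤ g (l * (1/8)) := by
    have h8 : (7:ℝ) < (1/8:ℝ) ^ (-ρ - 1) := by
      have : (8:ℝ) ^ (1:ℝ) ≤ 8 ^ (ρ + 1) :=
        Real.rpow_le_rpow_of_exponent_le (by norm_num) (by linarith)
      rw [one_div, Real.inv_rpow (by norm_num), ← Real.rpow_neg (by norm_num)]
      rw [Real.rpow_one] at this
      rw [show -(-ρ - 1) = ρ + 1 by ring]
      linarith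
    filter_upwards [(hreg (1/8) (by norm_num)).eventually (lt_mem_nhds h8), self_mem_nhdsWithin]
      with l h1 h2
    have h2' : 0 < l := h2
    rw [hgd l h2', hgd _ (by positivity), lt_div_iff₀ (hgpos l h2')] at h1
    exact h1.le
  obtain ⟨T, hT1, hT⟩ : ∃ T : ℝ, 1 ≤ T ∧ ∀ t, T ≤ t → 7 * g t⁻¹ ≤ g (t⁻¹ * (1/8)) := by
    have := (tendsto_inv_atTop_nhdsGT_zero (𝕜 := ℝ)).eventually hev
    obtain ⟨T, hT⟩ := eventually_atTop.1 this
    exact ⟨max 1 T, le_max_left _ _, fun t ht => hT t ((le_max_right _ _).trans ht)⟩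
  have hT0 : 0 < T := by linarith
  have hdT := hA1.1 T hT0
  have hgT := hgpos T⁻¹ (inv_pos.2 hT0)
  have he1 : 1 ≤ Real.exp 1 := Real.one_le_exp (by norm_num)
  refine ⟨min (1/16) (dens T / g T⁻¹), 4 * Real.exp 1, by positivity, ?_, ?_⟩
  · exact (min_le_left _ _).trans (by linarith)
  intro t ht
  have ht0 : 0 < t := by linarith
  have hgt := hgpos t⁻¹ (inv_pos.2 ht0)
  rw [hgd _ (inv_pos.2 ht0)]
  refine ⟨?_, hup t ht0⟩
  rcases le_total T t with h | h
  · have h1 := hT t h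
    have h2 := hlow t ht0
    have he := Real.exp_one_lt_d9
    have h3 : Real.exp 1 * g t⁻¹ ≤ 3 * g t⁻¹ := by gcongr; linarith
    calc _ ≤ 1/16 * (g t⁻¹ / t ^ 2) := by gcongr; exact min_le_left _ _
      _ ≤ dens t := by
        rw [← mul_div_assoc, div_le_iff₀ (by positivity)]
        linarith
  · calc _ ≤ dens T / g T⁻¹ * (g t⁻¹ / t ^ 2) := by gcongr; exact min_le_right _ _
      _ ≤ dens T / g T⁻¹ * g T⁻¹ := by
        gcongr
        calc g t⁻¹ / t ^ 2 ≤ g t⁻¹ := div_le_self hgt.le (by nlinarith)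
          _ ≤ g T⁻¹ := hanti _ _ (inv_pos.2 hT0) (by gcongr)
      _ = dens T := div_mul_cancel₀ _ hgT.ne'
      _ ≤ dens t := hmono t T ht0 h
end

section
/- Let f be a completely monotone function with ω₀ > −∞ and define g:(0,∞)→ℝ by g(λ) := f_e(λ + ω₀). Assume g is completely monotone, its representing measure has a density, and for some λ₀ > 0: (i) (−λ)^n g^{(n)}(λ)/n! ≥ (−λ)^{n+1} g^{(n+1)}(λ)/(n+1)! for every integer n ≥ 0 and λ > λ₀, and (ii) lim_{λ→∞} g(λ) = 0. Then the representing measure of f has a density ν(t) such that t ↦ e^{−ω₀ t} ν(t) is non-increasing. -/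
open MeasureTheory Filter Set Topology

lemma pois_term {θ l x : ℝ} {n : ℕ} (hθ : 0 < θ) (h : 0 ≤ ((n:ℝ) - x * l) * Real.log θ) :
    1 ≤ θ ^ n * Real.exp (-(x * l * Real.log θ)) := by
  have : θ ^ n = Real.exp (n * Real.log θ) := by
    rw [← Real.log_pow, Real.exp_log (by positivity)]
  rw [this, ← Real.exp_add]
  apply Real.one_le_exp
  linarith

noncomputable def pois (l x t : ℝ) : ℝ :=
  ∑ n ∈ Finset.range ⌈x * l⌉₊, (l * t) ^ n / (n.factorial : ℝ) * Real.exp (-(l * t))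

lemma pois_nonneg {l x t : ℝ} (hl : 0 ≤ l) (ht : 0 ≤ t) : 0 ≤ pois l x t :=
  Finset.sum_nonneg fun n _ => by positivity

lemma pois_upper {θ l x t : ℝ} (hθ : 0 < θ) (hθ1 : θ ≤ 1) (hl : 0 ≤ l) (ht : 0 ≤ t) :
    pois l x t ≤ Real.exp (-(l * (t - θ * t + x * Real.log θ))) := by
  have h1 : pois l x t ≤ ∑ n ∈ Finset.range ⌈x * l⌉₊, (θ * (l * t)) ^ n / (n.factorial : ℝ) *
      (Real.exp (-(l * t)) * Real.exp (-(x * l * Real.log θ))) := by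
    apply Finset.sum_le_sum
    intro n hn
    have hn' : (n:ℝ) < x * l := Nat.lt_ceil.1 (Finset.mem_range.1 hn)
    have h2 := pois_term (l := l) (x := x) (n := n) hθ
      (mul_nonneg_of_nonpos_of_nonpos (by linarith) (Real.log_nonpos hθ.le hθ1))
    calc (l * t) ^ n / (n.factorial : ℝ) * Real.exp (-(l * t))
        ≤ ((l * t) ^ n / (n.factorial : ℝ) * Real.exp (-(l * t))) *
          (θ ^ n * Real.exp (-(x * l * Real.log θ))) :=
          le_mul_of_one_le_right (by positivity) h2
      _ = _ := by rw [mul_pow]; ring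
  refine h1.trans ?_
  rw [← Finset.sum_mul]
  have h3 := Real.sum_le_exp_of_nonneg (x := θ * (l * t)) (by positivity) ⌈x * l⌉₊
  calc _ ≤ Real.exp (θ * (l * t)) * (Real.exp (-(l * t)) * Real.exp (-(x * l * Real.log θ))) :=
        mul_le_mul_of_nonneg_right h3 (by positivity)
    _ = _ := by
        rw [← Real.exp_add, ← Real.exp_add]; congr 1; ring

lemma pois_le_one {l x t : ℝ} (hl : 0 ≤ l) (ht : 0 ≤ t) : pois l x t ≤ 1 := by
  simpa using pois_upper (θ := 1) (x := x) one_pos le_rfl hl ht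

lemma pois_lower {θ l x t : ℝ} (hθ1 : 1 ≤ θ) (hl : 0 ≤ l) (ht : 0 ≤ t) :
    1 - pois l x t ≤ Real.exp (-(l * (t - θ * t + x * Real.log θ))) := by
  have hθ : 0 < θ := by linarith
  have hs (y : ℝ) : HasSum (fun n : ℕ => y ^ n / (n.factorial : ℝ)) (Real.exp y) := by
    rw [Real.exp_eq_exp_ℝ]; exact NormedSpace.expSeries_div_hasSum_exp y
  have hA := (hs (l * t)).mul_right (Real.exp (-(l * t)))
  have hB := (hs (θ * (l * t))).mul_right
      (Real.exp (-(l * t)) * Real.exp (-(x * l * Real.log θ)))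
  have hC := hasSum_sum_of_ne_finset_zero (L := SummationFilter.unconditional ℕ)
    (f := fun n => if n ∈ Finset.range ⌈x * l⌉₊ then
      (l * t) ^ n / (n.factorial : ℝ) * Real.exp (-(l * t)) else 0)
    (s := Finset.range ⌈x * l⌉₊) (by intro b hb; simp [hb])
  have hC' : (∑ n ∈ Finset.range ⌈x * l⌉₊, if n ∈ Finset.range ⌈x * l⌉₊ then
      (l * t) ^ n / (n.factorial : ℝ) * Real.exp (-(l * t)) else 0) = pois l x t :=
    Finset.sum_congr rfl fun n hn => by rw [if_pos hn]
  rw [hC'] at hC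
  have key := hasSum_le (fun n => ?_) hA (hC.add hB)
  · rw [← Real.exp_add, ← Real.exp_add, ← Real.exp_add] at key
    simp only [add_neg_cancel, Real.exp_zero] at key
    have : θ * (l * t) + (-(l * t) + -(x * l * Real.log θ)) =
      -(l * (t - θ * t + x * Real.log θ)) := by ring
    rw [this] at key
    linarith
  · by_cases hn : n ∈ Finset.range ⌈x * l⌉₊
    · simp only [hn, if_true]
      have : 0 ≤ (θ * (l * t)) ^ n / (n.factorial : ℝ) *
        (Real.exp (-(l * t)) * Real.exp (-(x * l * Real.log θ))) := by positivity
      linarith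
    · simp only [hn, if_false, zero_add]
      have hn' : x * l ≤ n := Nat.ceil_le.1 (by simpa using hn)
      have h2 := pois_term (l := l) (x := x) (n := n) hθ
        (mul_nonneg (by linarith) (Real.log_nonneg hθ1))
      calc (l * t) ^ n / (n.factorial : ℝ) * Real.exp (-(l * t))
        ≤ ((l * t) ^ n / (n.factorial : ℝ) * Real.exp (-(l * t))) *
          (θ ^ n * Real.exp (-(x * l * Real.log θ))) :=
          le_mul_of_one_le_right (by positivity) h2
      _ = _ := by rw [mul_pow]; ring

lemma exp_decay {c : ℝ} (hc : 0 < c) :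
    Tendsto (fun l : ℝ => Real.exp (-(l * c))) atTop (𝓝 0) :=
  Real.tendsto_exp_neg_atTop_nhds_zero.comp (tendsto_id.atTop_mul_const hc)

lemma pois_tendsto {x t : ℝ} (hx : 0 < x) (ht : 0 < t) (hxt : t ≠ x) :
    Tendsto (fun l : ℝ => pois l x t) atTop (𝓝 ((Iic x).indicator (fun _ => (1:ℝ)) t)) := by
  have hlog : 0 < t - (x / t) * t + x * Real.log (x / t) := by
    have h1 := Real.log_lt_sub_one_of_pos (x := t / x) (by positivity)
      (by rw [Ne, div_eq_one_iff_eq hx.ne']; exact hxt)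
    have h2 : Real.log (x / t) = - Real.log (t / x) := by rw [← Real.log_inv, inv_div]
    have h3 : x * Real.log (t / x) < x * (t / x - 1) := mul_lt_mul_of_pos_left h1 hx
    have h4 : x * (t / x - 1) = t - x := by field_simp
    rw [h2, div_mul_cancel₀ _ ht.ne']
    linarith
  have hd := exp_decay hlog
  rcases lt_or_gt_of_ne hxt with h | h
  · rw [indicator_of_mem (show t ∈ Iic x from h.le)]
    have : Tendsto (fun l : ℝ => 1 - Real.exp (-(l * (t - (x / t) * t + x * Real.log (x / t)))))
      atTop (𝓝 1) := by simpa using hd.const_sub 1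
    refine tendsto_of_tendsto_of_tendsto_of_le_of_le' this tendsto_const_nhds ?_ ?_
    · filter_upwards [eventually_ge_atTop 0] with l hl
      have := pois_lower (θ := x / t) (x := x) ((one_le_div ht).2 h.le) hl ht.le
      linarith
    · filter_upwards [eventually_ge_atTop 0] with l hl
      exact pois_le_one hl ht.le
  · rw [indicator_of_notMem (show t ∉ Iic x from not_le.2 h)]
    refine tendsto_of_tendsto_of_tendsto_of_le_of_le' tendsto_const_nhds hd ?_ ?_
    · filter_upwards [eventually_ge_atTop 0] with l hl
      exact pois_nonneg hl ht.le
    · filter_upwards [eventually_ge_atTop 0] with l hl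
      exact pois_upper (by positivity) ((div_le_one ht).2 h.le) hl ht.le

lemma pois_dom {l x t : ℝ} (hx : 0 < x) (hl : 1 ≤ l) (ht : 0 ≤ t) :
    pois l x t ≤ Real.exp x * Real.exp (-(1/4 * t)) := by
  rw [← Real.exp_add]
  rcases le_total t (4 * x) with h | h
  · refine (pois_le_one (by linarith) ht).trans (Real.one_le_exp (by linarith))
  · refine (pois_upper (θ := 1/2) (by norm_num) (by norm_num) (by linarith) ht).trans ?_
    apply Real.exp_le_exp.2
    have h1 : Real.log (1/2) = - Real.log 2 := by rw [one_div, Real.log_inv]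
    have h2 := Real.log_two_lt_d9
    have h2' := Real.log_two_gt_d9
    rw [h1]
    have h3 : x * Real.log 2 ≤ x := by nlinarith
    have h4 : 1/4 * t ≤ t - 1/2 * t + x * (- Real.log 2) := by linarith
    nlinarith

lemma pois_lim {η : Measure ℝ} (hpos : ∀ᵐ t ∂η, 0 < t) (hat : ∀ x, η {x} = 0)
    (hint : Integrable (fun t : ℝ => Real.exp (-(1/4 * t))) η) {x : ℝ} (hx : 0 < x) :
    Tendsto (fun l : ℝ => ∫ t, pois l x t ∂η) atTop (𝓝 (η.real (Iic x))) := by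
  have h0 : η.real (Iic x) = ∫ t, (Iic x).indicator (fun _ => (1:ℝ)) t ∂η := by
    rw [integral_indicator measurableSet_Iic]; simp
  rw [h0]
  refine tendsto_integral_filter_of_dominated_convergence _ ?_ ?_ (hint.const_mul (Real.exp x)) ?_
  · refine Eventually.of_forall fun l => Continuous.aestronglyMeasurable ?_
    unfold pois; fun_prop
  · filter_upwards [eventually_ge_atTop 1] with l hl
    filter_upwards [hpos] with t ht
    rw [Real.norm_of_nonneg (pois_nonneg (by linarith) ht.le)]
    exact pois_dom hx hl ht.le
  · have : ∀ᵐ t ∂η, t ≠ x := by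
      rw [ae_iff]; simpa using hat x
    filter_upwards [hpos, this] with t ht htx
    exact pois_tendsto hx ht htx

lemma discrete_concave {a : ℕ → ℝ} (ha : Antitone a) {i j k : ℕ} (hij : i ≤ j) (hjk : j ≤ k) :
    ((j:ℝ) - i) * (∑ n ∈ Finset.range k, a n - ∑ n ∈ Finset.range j, a n) ≤
    ((k:ℝ) - j) * (∑ n ∈ Finset.range j, a n - ∑ n ∈ Finset.range i, a n) := by
  rw [← Finset.sum_Ico_eq_sub _ hij, ← Finset.sum_Ico_eq_sub _ hjk]
  have h1 : ∑ n ∈ Finset.Ico j k, a n ≤ ((k:ℝ) - j) * a j := by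
    have := Finset.sum_le_card_nsmul (Finset.Ico j k) a (a j)
      (fun n hn => ha (Finset.mem_Ico.1 hn).1)
    simpa [Nat.cast_sub hjk] using this
  have h2 : ((j:ℝ) - i) * a j ≤ ∑ n ∈ Finset.Ico i j, a n := by
    have := Finset.card_nsmul_le_sum (Finset.Ico i j) a (a j)
      (fun n hn => ha (Finset.mem_Ico.1 hn).2.le)
    simpa [Nat.cast_sub hij] using this
  have hij' : (0:ℝ) ≤ (j:ℝ) - i := by simpa using hij
  have hjk' : (0:ℝ) ≤ (k:ℝ) - j := by simpa using hjk
  calc _ ≤ ((j:ℝ) - i) * (((k:ℝ) - j) * a j) := mul_le_mul_of_nonneg_left h1 hij'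
    _ = ((k:ℝ) - j) * (((j:ℝ) - i) * a j) := by ring
    _ ≤ _ := mul_le_mul_of_nonneg_left h2 hjk'

lemma F_concave {η : Measure ℝ} (hpos : ∀ᵐ t ∂η, 0 < t) (hat : ∀ x, η {x} = 0)
    (hint : Integrable (fun t : ℝ => Real.exp (-(1/4 * t))) η)
    (hmom : ∀ (n : ℕ) (l : ℝ), 0 < l → Integrable (fun t : ℝ => t ^ n * Real.exp (-(l * t))) η)
    {l₀ : ℝ} (hl₀ : 0 < l₀)
    (hi : ∀ (n : ℕ) (l : ℝ), l₀ < l →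
      ∫ t, (l * t) ^ (n+1) / ((n+1).factorial : ℝ) * Real.exp (-(l * t)) ∂η ≤
      ∫ t, (l * t) ^ n / (n.factorial : ℝ) * Real.exp (-(l * t)) ∂η) :
    ConcaveOn ℝ (Ioi 0) (fun x => η.real (Iic x)) := by
  refine concaveOn_of_slope_anti_adjacent (convex_Ioi 0) ?_
  intro x y z hx hz hxy hyz
  have hx : 0 < x := hx
  have hy : 0 < y := hx.trans hxy
  have hz : 0 < z := hz
  rw [div_le_div_iff₀ (by linarith) (by linarith)]
  have hp : ∀ x : ℝ, ∀ l : ℝ, 0 < l → ∫ t, pois l x t ∂η = ∑ n ∈ Finset.range ⌈x * l⌉₊,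
      ∫ t, (l * t) ^ n / (n.factorial : ℝ) * Real.exp (-(l * t)) ∂η := by
    intro x l hl
    unfold pois
    rw [integral_finsetSum]
    intro n _
    convert (hmom n l hl).const_mul (l ^ n / (n.factorial : ℝ)) using 2 with t
    rw [mul_pow]; ring
  have Lx := pois_lim hpos hat hint hx
  have Ly := pois_lim hpos hat hint hy
  have Lz := pois_lim hpos hat hint hz
  have cx := tendsto_nat_ceil_mul_div_atTop hx.le
  have cy := tendsto_nat_ceil_mul_div_atTop hy.le
  have cz := tendsto_nat_ceil_mul_div_atTop hz.le
  have A := (Lz.sub Ly).mul (cy.sub cx)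
  have B := (Ly.sub Lx).mul (cz.sub cy)
  refine le_of_tendsto_of_tendsto A B ?_
  filter_upwards [eventually_gt_atTop l₀] with l hl
  have hl' : 0 < l := hl₀.trans hl
  have han : Antitone (fun n : ℕ =>
      ∫ t, (l * t) ^ n / (n.factorial : ℝ) * Real.exp (-(l * t)) ∂η) :=
    antitone_nat_of_succ_le fun n => hi n l hl
  have := discrete_concave han (i := ⌈x * l⌉₊) (j := ⌈y * l⌉₊) (k := ⌈z * l⌉₊)
    (Nat.ceil_mono (by nlinarith)) (Nat.ceil_mono (by nlinarith))
  simp only [hp _ l hl']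
  rw [← sub_div, ← sub_div, mul_div_assoc', mul_div_assoc', div_le_div_iff_of_pos_right hl']
  linarith

open ProbabilityTheory in
lemma mem_interior_expSet {μ : Measure ℝ} {c : ℝ}
    (h : ∀ l : ℝ, c < l → Integrable (fun t : ℝ => Real.exp (-(l * t))) μ) {l : ℝ} (hl : c < l) :
    l ∈ interior (integrableExpSet (fun t : ℝ => -t) μ) := by
  refine mem_interior.2 ⟨Ioi c, ?_, isOpen_Ioi, hl⟩
  intro y hy
  have := h y hy
  simpa [integrableExpSet] using this

open ProbabilityTheory in
lemma laplace_moments {g : ℝ → ℝ} {η : Measure ℝ} {c : ℝ}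
    (h : ∀ l : ℝ, c < l → Integrable (fun t : ℝ => Real.exp (-(l * t))) η)
    (n : ℕ) {l : ℝ} (hl : c < l) :
    Integrable (fun t : ℝ => t ^ n * Real.exp (-(l * t))) η := by
  have hmem := mem_interior_expSet h hl
  have h1 := (integrable_pow_mul_exp_of_mem_interior_integrableExpSet hmem n).const_mul ((-1)^n)
  convert h1 using 2 with t
  rw [neg_pow t, ← mul_assoc, ← mul_assoc, ← mul_pow]
  simp

open ProbabilityTheory in
lemma laplace_deriv {g : ℝ → ℝ} {η : Measure ℝ} (hη : IsRepMeasure g η)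
    (n : ℕ) {l : ℝ} (hl : 0 < l) :
    iteratedDeriv n g l = ∫ t, (-t) ^ n * Real.exp (-(l * t)) ∂η := by
  have hmem := mem_interior_expSet (fun l hl => (hη.2 l hl).1) hl
  have h1 : g =ᶠ[𝓝 l] mgf (fun t : ℝ => -t) η := by
    filter_upwards [Ioi_mem_nhds hl] with y hy
    rw [(hη.2 y hy).2]
    simp [mgf]
  rw [h1.iteratedDeriv_eq n, iteratedDeriv_mgf hmem]
  simp

lemma laplace_unique_aux {μ μ' : Measure ℝ}
    (h : ∀ l : ℝ, -1 < l → Integrable (fun t : ℝ => Real.exp (-(l * t))) μ)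
    (h' : ∀ l : ℝ, -1 < l → Integrable (fun t : ℝ => Real.exp (-(l * t))) μ')
    (heq : ∀ l : ℝ, -1 < l →
      ∫ t, Real.exp (-(l * t)) ∂μ = ∫ t, Real.exp (-(l * t)) ∂μ') : μ = μ' := by
  have f1 : IsFiniteMeasure μ := by
    have := h 0 (by norm_num)
    simpa [integrable_const_iff] using this
  have f2 : IsFiniteMeasure μ' := by
    have := h' 0 (by norm_num)
    simpa [integrable_const_iff] using this
  have hX : AnalyticOnNhd ℂ (ProbabilityTheory.complexMGF (fun t : ℝ => -t) μ)
      {z | z.re ∈ Ioi (-1:ℝ)} := fun z hz =>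
    ProbabilityTheory.analyticAt_complexMGF (mem_interior_expSet h hz)
  have hY : AnalyticOnNhd ℂ (ProbabilityTheory.complexMGF (fun t : ℝ => -t) μ')
      {z | z.re ∈ Ioi (-1:ℝ)} := fun z hz =>
    ProbabilityTheory.analyticAt_complexMGF (mem_interior_expSet h' hz)
  have hE : EqOn (ProbabilityTheory.complexMGF (fun t : ℝ => -t) μ)
      (ProbabilityTheory.complexMGF (fun t : ℝ => -t) μ') {z | z.re ∈ Ioi (-1:ℝ)} := by
    refine AnalyticOnNhd.eqOn_of_preconnected_of_frequently_eq hX hY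
      ((convex_Ioi (-1:ℝ)).linear_preimage Complex.reLm).isPreconnected
      (z₀ := ((0:ℝ) : ℂ)) (by simp) ?_
    have h_real : ∃ᶠ (x : ℝ) in 𝓝[≠] 0, ProbabilityTheory.complexMGF (fun t : ℝ => -t) μ x
        = ProbabilityTheory.complexMGF (fun t : ℝ => -t) μ' x := by
      apply Eventually.frequently
      filter_upwards [mem_nhdsWithin_of_mem_nhds (Ioi_mem_nhds (show (-1:ℝ) < 0 by norm_num))]
        with y hy
      rw [ProbabilityTheory.complexMGF_ofReal, ProbabilityTheory.complexMGF_ofReal]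
      have := heq y hy
      simp [ProbabilityTheory.mgf, this]
    rw [frequently_iff_seq_forall] at h_real ⊢
    obtain ⟨xs, hx_tendsto, hx_eq⟩ := h_real
    refine ⟨fun n ↦ xs n, ?_, fun n ↦ ?_⟩
    · rw [tendsto_nhdsWithin_iff] at hx_tendsto ⊢
      constructor
      · exact (Complex.continuous_ofReal.tendsto 0).comp hx_tendsto.1
      · simpa using hx_tendsto.2
    · simp [hx_eq]
  apply Measure.ext_of_charFun
  ext y
  have hz : (Complex.I * ((-y : ℝ) : ℂ)) ∈ {z : ℂ | z.re ∈ Ioi (-1:ℝ)} := by simp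
  have := hE hz
  simp only [ProbabilityTheory.complexMGF] at this
  rw [charFun_apply_real, charFun_apply_real]
  convert this using 4 <;> · push_cast; ring

lemma laplace_withDensity {μ : Measure ℝ} (c l : ℝ) :
    (Integrable (fun t : ℝ => Real.exp (-(l * t)))
      (μ.withDensity fun t => ENNReal.ofReal (Real.exp (c * t))) ↔
      Integrable (fun t : ℝ => Real.exp (-((l - c) * t))) μ) ∧
    ∫ t, Real.exp (-(l * t)) ∂(μ.withDensity fun t => ENNReal.ofReal (Real.exp (c * t))) =
      ∫ t, Real.exp (-((l - c) * t)) ∂μ := by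
  have e : ∀ t : ℝ, (ENNReal.ofReal (Real.exp (c * t))).toReal • Real.exp (-(l * t)) =
      Real.exp (-((l - c) * t)) := by
    intro t
    rw [ENNReal.toReal_ofReal (Real.exp_pos _).le, smul_eq_mul, ← Real.exp_add]
    congr 1; ring
  constructor
  · rw [integrable_withDensity_iff_integrable_smul' (by fun_prop) (by simp)]
    simp only [e]
  · rw [integral_withDensity_eq_integral_toReal_smul (by fun_prop) (by simp)]
    simp only [e]

lemma withDensity_exp_cancel (μ : Measure ℝ) (c : ℝ) :
    (μ.withDensity fun t => ENNReal.ofReal (Real.exp (-c * t))).withDensity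
      (fun t => ENNReal.ofReal (Real.exp (c * t))) = μ := by
  rw [← withDensity_mul _ (by fun_prop) (by fun_prop)]
  convert withDensity_one using 2
  ext t
  rw [Pi.mul_apply, ← ENNReal.ofReal_mul (Real.exp_pos _).le, ← Real.exp_add]
  simp

lemma laplace_unique {μ μ' : Measure ℝ}
    (h : ∀ l : ℝ, 0 < l → Integrable (fun t : ℝ => Real.exp (-(l * t))) μ)
    (h' : ∀ l : ℝ, 0 < l → Integrable (fun t : ℝ => Real.exp (-(l * t))) μ')
    (heq : ∀ l : ℝ, 0 < l →
      ∫ t, Real.exp (-(l * t)) ∂μ = ∫ t, Real.exp (-(l * t)) ∂μ') : μ = μ' := by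
  rw [← withDensity_exp_cancel μ 1, ← withDensity_exp_cancel μ' 1]
  congr 1
  apply laplace_unique_aux
  · intro l hl; rw [(laplace_withDensity _ _).1]; exact h _ (by linarith)
  · intro l hl; rw [(laplace_withDensity _ _).1]; exact h' _ (by linarith)
  · intro l hl; rw [(laplace_withDensity _ _).2, (laplace_withDensity _ _).2]
    exact heq _ (by linarith)

noncomputable def rder (η : Measure ℝ) (x : ℝ) : ℝ :=
  derivWithin (fun x => η.real (Iic x)) (Ioi x) x

lemma rder_props {η : Measure ℝ} (hpos : η (Iic 0) = 0) (hfin : ∀ x, η (Iic x) ≠ ⊤)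
    (hc : ConcaveOn ℝ (Ioi 0) (fun x => η.real (Iic x))) :
    AntitoneOn (rder η) (Ioi 0) ∧ (∀ x, 0 ≤ rder η x) ∧
    η = (volume.restrict (Ioi (0:ℝ))).withDensity (fun t => ENNReal.ofReal (rder η t)) := by
  have hmono : Monotone (fun x => η.real (Iic x)) := fun x y hxy =>
    measureReal_mono (Iic_subset_Iic.2 hxy) (hfin y)
  have hnn : ∀ x, 0 ≤ rder η x := fun x => (hmono.monotoneOn _).derivWithin_nonneg
  have hcv := hc.neg
  have hder : ∀ x, 0 < x → HasDerivWithinAt (fun x => η.real (Iic x)) (rder η x) (Ioi x) x := by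
    intro x hx
    have := (hcv.differentiableWithinAt_Ioi_of_mem_interior (x := x) (by simpa using hx)).neg
    simp only [Pi.neg_def, neg_neg] at this
    exact this.hasDerivWithinAt
  have hanti : AntitoneOn (rder η) (Ioi 0) := by
    have := hcv.monotoneOn_rightDeriv
    rw [interior_Ioi] at this
    intro x hx y hy hxy
    have h1 := this hx hy hxy
    simp only [Pi.neg_def] at h1
    rw [(hder x hx).fun_neg.derivWithin (uniqueDiffWithinAt_Ioi x),
      (hder y hy).fun_neg.derivWithin (uniqueDiffWithinAt_Ioi y)] at h1
    linarith
  have hcont : ContinuousOn (fun x => η.real (Iic x)) (Ici 0) := by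
    intro x hx
    rcases eq_or_lt_of_le (show 0 ≤ x from hx) with rfl | hx
    · rw [← continuousWithinAt_Ioi_iff_Ici]
      have := tendsto_measure_biInter_gt (μ := η) (s := fun x => Iic x) (a := (0:ℝ))
        (fun r _ => measurableSet_Iic.nullMeasurableSet)
        (fun i j _ hij => Iic_subset_Iic.2 hij) ⟨1, one_pos, hfin 1⟩
      have e : (⋂ r, ⋂ (_ : r > (0:ℝ)), Iic r) = Iic 0 := by
        ext y; simp only [mem_iInter, mem_Iic]
        exact ⟨fun h => le_of_forall_gt_imp_ge_of_dense fun r hr => h r hr,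
          fun h r hr => h.trans hr.le⟩
      rw [e] at this
      exact (ENNReal.tendsto_toReal (hfin 0)).comp this
    · have := hc.continuousOn_interior
      rw [interior_Ioi] at this
      exact (this.continuousAt (Ioi_mem_nhds hx)).continuousWithinAt
  refine ⟨hanti, hnn, ?_⟩
  set ρ := (volume.restrict (Ioi (0:ℝ))).withDensity (fun t => ENNReal.ofReal (rder η t)) with hρ
  have hρ0 : ρ (Iic 0) = 0 := by
    apply withDensity_absolutelyContinuous
    rw [Measure.restrict_apply measurableSet_Iic]
    simp [Iic_inter_Ioi]
  have key : ∀ a b : ℝ, 0 ≤ a → η (Ioc a b) = ρ (Ioc a b) := by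
    intro a b ha
    rcases le_total b a with hab | hab
    · simp [Ioc_eq_empty (not_lt.2 hab)]
    have hc' : ContinuousOn (fun x => η.real (Iic x)) (Icc a b) :=
      hcont.mono fun x hx => ha.trans hx.1
    have hd' : ∀ x ∈ Ioo a b,
        HasDerivWithinAt (fun x => η.real (Iic x)) (rder η x) (Ioi x) x :=
      fun x hx => hder x (ha.trans_lt hx.1)
    have hI := intervalIntegral.integrableOn_deriv_right_of_nonneg hc' hd' (fun x _ => hnn x)
    have hF := intervalIntegral.integral_eq_sub_of_hasDeriv_right_of_le hab hc' hd'
      ((intervalIntegrable_iff_integrableOn_Ioc_of_le hab).2 hI)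
    rw [hρ, withDensity_apply _ measurableSet_Ioc, Measure.restrict_restrict measurableSet_Ioc,
      inter_eq_left.2 (show Ioc a b ⊆ Ioi 0 from fun x hx => ha.trans_lt hx.1),
      ← ofReal_integral_eq_lintegral_ofReal hI (Eventually.of_forall hnn),
      ← intervalIntegral.integral_of_le hab, hF, show Ioc a b = Iic b \ Iic a by
        ext t; simp [and_comm],
      ← measureReal_diff (Iic_subset_Iic.2 hab) measurableSet_Iic (hfin b),
      ofReal_measureReal (measure_ne_top_of_subset diff_subset (hfin b))]
  refine Measure.ext_of_Ioc' _ _ (fun a b _ => measure_ne_top_of_subset Ioc_subset_Iic_self (hfin b)) ?_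
  intro a b _
  have split : ∀ m : Measure ℝ, m (Iic 0) = 0 → m (Ioc a b) = m (Ioc (max a 0) b) := by
    intro m hm
    apply measure_congr
    have : ∀ᵐ t ∂m, 0 < t := by
      rw [ae_iff]; simpa [Iic] using hm
    filter_upwards [this] with t ht
    apply propext
    change (a < t ∧ t ≤ b) ↔ (max a 0 < t ∧ t ≤ b)
    simp [ht]
  rw [split η hpos, split ρ hρ0, key _ _ (le_max_right _ _)]

open ProbabilityTheory in
lemma compact_case {f : ℝ → ℝ} {ν : Measure ℝ} (hν : IsRepMeasure f ν) {T : ℝ} (hT : 0 < T)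
    (h0 : ν (Ioi T) = 0) : DerivsFinite f ∧ ∀ l, Summable (tser f l) := by
  have hae : ∀ᵐ t ∂ν, 0 ≤ t ∧ t ≤ T := by
    have h1 : ∀ᵐ t ∂ν, 0 ≤ t := by rw [ae_iff]; simpa using hν.1
    have h2 : ∀ᵐ t ∂ν, t ≤ T := by rw [ae_iff]; simpa [Ioi] using h0
    exact h1.and h2
  have hint : ∀ l : ℝ, Integrable (fun t : ℝ => Real.exp (-(l * t))) ν := by
    intro l
    refine ((hν.2 1 one_pos).1.mul_const (Real.exp (|1 - l| * T))).mono'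
      (by fun_prop) ?_
    filter_upwards [hae] with t ht
    rw [Real.norm_of_nonneg (Real.exp_pos _).le, ← Real.exp_add]
    apply Real.exp_le_exp.2
    have h1 : (1 - l) * t ≤ |1 - l| * T :=
      mul_le_mul (le_abs_self _) ht.2 ht.1 (abs_nonneg _)
    linarith
  have hmem : ∀ l : ℝ, l ∈ interior (integrableExpSet (fun t : ℝ => -t) ν) := fun l =>
    mem_interior_expSet (c := l - 1) (fun l _ => hint l) (by linarith)
  have hfin : IsFiniteMeasure ν := by
    have := hint 0
    simpa [integrable_const_iff] using this
  have hlim : ∀ n, Tendsto (iteratedDeriv n f) (𝓝[>] 0) (𝓝 (∫ t, (-t) ^ n ∂ν)) := by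
    intro n
    have h1 := (differentiableAt_iteratedDeriv_mgf (hmem 0) n).continuousAt.tendsto
    rw [iteratedDeriv_mgf (hmem 0)] at h1
    simp only [zero_mul, Real.exp_zero, mul_one] at h1
    refine (h1.mono_left nhdsWithin_le_nhds).congr' ?_
    filter_upwards [self_mem_nhdsWithin] with l hl
    rw [laplace_deriv hν n hl, iteratedDeriv_mgf (hmem l)]
    simp
  have hd : ∀ n, dplus f n = ∫ t, (-t) ^ n ∂ν := fun n => (hlim n).limUnder_eq
  refine ⟨fun n => by rw [hd]; exact hlim n, fun l => ?_⟩
  have hs := (Real.summable_pow_div_factorial (T * |l|)).mul_left (ν.real univ)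
  refine Summable.of_norm_bounded hs fun n => ?_
  have hb : ‖∫ t, (-t) ^ n ∂ν‖ ≤ T ^ n * ν.real univ := by
    apply norm_integral_le_of_norm_le_const
    filter_upwards [hae] with t ht
    rw [norm_pow, norm_neg, Real.norm_of_nonneg ht.1]
    exact pow_le_pow_left₀ ht.1 ht.2 n
  rw [tser, hd, norm_mul, norm_div, norm_pow, norm_neg, Real.norm_eq_abs l, RCLike.norm_natCast]
  calc _ ≤ T ^ n * ν.real univ / (n.factorial : ℝ) * |l| ^ n := by gcongr
    _ = _ := by rw [mul_pow]; ring

/-- Corollary 3.3: let `g(λ) := f_e(λ + ω₀)`. If `g` satisfies the assumptions of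
Proposition 3.1, then the representing measure of `f` has a density `dens` such that
`t ↦ e^{-ω₀ t} dens t` is non-increasing. -/
theorem stmt_10 (f fe g gdens : ℝ → ℝ) (ν η : MeasureTheory.Measure ℝ) (ω₀ l₀ : ℝ)
    (hf : CompMono f) (hν : IsRepMeasure f ν)
    (hω : IsAbscissa f ω₀) (hfe : IsExtension f fe ω₀)
    (hg : ∀ l : ℝ, g l = fe (l + ω₀))
    (hgCM : CompMono g) (hη : IsRepMeasure g η) (hgA1 : HasDensity η gdens)
    (hl₀ : 0 < l₀)
    (hi : ∀ (n : ℕ) (l : ℝ), l₀ < l →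
      (-l) ^ (n + 1) * iteratedDeriv (n + 1) g l / ((n + 1).factorial : ℝ) ≤
        (-l) ^ n * iteratedDeriv n g l / (n.factorial : ℝ))
    (hii : Filter.Tendsto g Filter.atTop (nhds 0)) :
    ∃ dens : ℝ → ℝ, HasDensity ν dens ∧
      ∀ s t : ℝ, 0 < s → s ≤ t →
        Real.exp (-(ω₀ * t)) * dens t ≤ Real.exp (-(ω₀ * s)) * dens s := by
  have hω0 : ω₀ ≤ 0 := by
    by_cases hD : DerivsFinite f
    · refine (hω.1 hD).1 ?_
      change Summable (tser f 0)
      refine summable_of_ne_finset_zero (s := {0}) fun n hn => ?_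
      have : n ≠ 0 := by simpa using hn
      simp [tser, this]
    · exact (hω.2 hD).le
  -- `η` is absolutely continuous
  have hac : η ≪ volume := by
    rw [hgA1.2]
    exact (withDensity_absolutelyContinuous _ _).trans Measure.restrict_le_self.absolutelyContinuous
  have hat : ∀ x, η {x} = 0 := fun x => hac (by simp)
  have hneg : η (Iic 0) = 0 := by
    rw [hgA1.2]
    apply withDensity_absolutelyContinuous
    rw [Measure.restrict_apply measurableSet_Iic]
    simp [Iic_inter_Ioi]
  have hpos : ∀ᵐ t ∂η, 0 < t := by
    rw [ae_iff]; simpa [Iic] using hneg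
  have hfin : ∀ x, η (Iic x) ≠ ⊤ := by
    intro x
    have h1 := (hη.2 1 one_pos).1.measure_ge_lt_top (ε := Real.exp (-x)) (Real.exp_pos _)
    refine measure_ne_top_of_subset ?_ h1.ne
    intro t ht
    have ht : t ≤ x := ht
    change Real.exp (-x) ≤ Real.exp (-(1 * t))
    exact Real.exp_le_exp.2 (by linarith)
  have hmom : ∀ (n : ℕ) (l : ℝ), 0 < l →
      Integrable (fun t : ℝ => t ^ n * Real.exp (-(l * t))) η := fun n l hl =>
    laplace_moments (g := g) (fun l hl => (hη.2 l hl).1) n hl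
  have hder : ∀ (n : ℕ) (l : ℝ), 0 < l → (-l) ^ n * iteratedDeriv n g l / (n.factorial : ℝ) =
      ∫ t, (l * t) ^ n / (n.factorial : ℝ) * Real.exp (-(l * t)) ∂η := by
    intro n l hl
    rw [laplace_deriv hη n hl, ← integral_const_mul, ← integral_div]
    congr 1
    ext t
    rw [← mul_assoc, ← mul_pow, neg_mul_neg]
    ring
  have hconc := F_concave hpos hat (hη.2 (1/4) (by norm_num)).1 hmom hl₀ (by
    intro n l hl
    rw [← hder n l (hl₀.trans hl), ← hder (n+1) l (hl₀.trans hl)]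
    exact hi n l hl)
  obtain ⟨hanti, hnn, hηD⟩ := rder_props hneg hfin hconc
  -- relation between `ν` and `η`
  have hνη : ν = η.withDensity (fun t => ENNReal.ofReal (Real.exp (ω₀ * t))) := by
    apply laplace_unique
    · exact fun l hl => (hν.2 l hl).1
    · intro l hl
      rw [(laplace_withDensity _ _).1]
      exact (hη.2 _ (by linarith)).1
    · intro l hl
      rw [(laplace_withDensity _ _).2, ← (hη.2 _ (by linarith)).2, ← (hν.2 l hl).2, hg,
        sub_add_cancel, hfe.1 l hl]
  have hDpos : ∀ t, 0 < t → 0 < rder η t := by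
    intro T hT
    by_contra hcon
    have hT0 : ∀ t ∈ Ioi T, ENNReal.ofReal (rder η t) = 0 := fun t ht =>
      ENNReal.ofReal_of_nonpos
        ((hanti hT (hT.trans ht) (le_of_lt ht)).trans (not_lt.1 hcon))
    have h1 : η (Ioi T) = 0 := by
      rw [hηD, withDensity_apply _ measurableSet_Ioi,
        Measure.restrict_restrict measurableSet_Ioi,
        inter_eq_left.2 (Ioi_subset_Ioi hT.le), setLIntegral_congr_fun measurableSet_Ioi hT0]
      simp
    have h2 : ν (Ioi T) = 0 := by
      rw [hνη]; exact withDensity_absolutelyContinuous _ _ h1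
    obtain ⟨hDF, hsum⟩ := compact_case hν hT h2
    have := (hω.1 hDF).1 (hsum (ω₀ - 1))
    linarith
  refine ⟨fun t => rder η t * Real.exp (ω₀ * t), ⟨fun t ht => ?_, ?_⟩, ?_⟩
  · exact mul_pos (hDpos t ht) (Real.exp_pos _)
  · rw [hνη]
    have hm : Measurable (rder η) := measurable_derivWithin_Ioi _
    conv_lhs => rw [hηD]
    rw [← withDensity_mul _ (by fun_prop) (by fun_prop)]
    congr 1
    ext t
    rw [Pi.mul_apply, ENNReal.ofReal_mul (hnn t)]
  · intro s t hs hst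
    have e : ∀ t, Real.exp (-(ω₀ * t)) * (rder η t * Real.exp (ω₀ * t)) = rder η t := by
      intro t
      rw [mul_left_comm, ← Real.exp_add]
      simp
    rw [e, e]
    exact hanti hs (hs.trans_le hst) hst
end

section
/- Let φ be a Bernstein function, β := −ω₀^{φ′}, and assume the Lévy measure of φ has a density μ(t) such that t ↦ e^{β t} μ(t) is non-increasing. Assume further there exist constants θ > 0, 0 ≤ Λ₁ < Λ₂ ≤ ∞ and γ > 0 such that φ_e″(λx − β)/φ_e″(λ − β) ≤ θ x^{−γ} for all x ≥ 1 and all λ ∈ (Λ₁, Λ₂). Then there exist constants c₂ > 0 and δ ∈ (0,1) such that μ(t) ≥ −c₂ t^{−3} φ_e″(t^{−1} − β) e^{−β t} for all t ∈ (δΛ₂^{−1}, δΛ₁^{−1}). -/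
open MeasureTheory Filter Set Topology

theorem aux_ae_pos {μ : Measure ℝ} (h : μ {t : ℝ | t ≤ 0} = 0) : ∀ᵐ t ∂μ, 0 < t := by
  rw [ae_iff]; simpa using h

theorem aux_int1 {φ : ℝ → ℝ} {a b : ℝ} {μ : Measure ℝ} (h : HasLevyTriple φ a b μ) {c : ℝ}
    (hc : 0 < c) : Integrable (fun t : ℝ => t * Real.exp (-(c * t))) μ := by
  obtain ⟨_, _, h0, _, hl⟩ := h
  refine ((hl c hc).1.div_const c).mono' (by fun_prop) ?_
  filter_upwards [aux_ae_pos h0] with t ht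
  rw [Real.norm_of_nonneg (by positivity), le_div_iff₀ hc]
  have h1 := Real.add_one_le_exp (c * t)
  have h2 : Real.exp (c * t) * Real.exp (-(c * t)) = 1 := by rw [← Real.exp_add]; simp
  nlinarith [Real.exp_pos (-(c * t))]

theorem aux_int2 {φ : ℝ → ℝ} {a b : ℝ} {μ : Measure ℝ} (h : HasLevyTriple φ a b μ) {c : ℝ}
    (hc : 0 < c) : Integrable (fun t : ℝ => t ^ 2 * Real.exp (-(c * t))) μ := by
  refine ((aux_int1 h (half_pos hc)).const_mul (2 / c)).mono' (by fun_prop) ?_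
  filter_upwards [aux_ae_pos h.2.2.1] with t ht
  rw [Real.norm_of_nonneg (by positivity)]
  have h1 := Real.add_one_le_exp (c / 2 * t)
  have h2 : Real.exp (c / 2 * t) * Real.exp (-(c / 2 * t)) = 1 := by rw [← Real.exp_add]; simp
  have h3 : Real.exp (-(c * t)) = Real.exp (-(c / 2 * t)) * Real.exp (-(c / 2 * t)) := by
    rw [← Real.exp_add]; ring_nf
  have h4 : c / 2 * t * Real.exp (-(c / 2 * t)) ≤ 1 := by
    nlinarith [Real.exp_pos (-(c / 2 * t))]
  have h5 : t * Real.exp (-(c / 2 * t)) ≤ 2 / c := by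
    rw [le_div_iff₀ hc]; linarith
  rw [h3]
  calc t ^ 2 * (Real.exp (-(c / 2 * t)) * Real.exp (-(c / 2 * t)))
      = (t * Real.exp (-(c / 2 * t))) * (t * Real.exp (-(c / 2 * t))) := by ring
    _ ≤ _ := by gcongr

theorem aux_d1 {φ : ℝ → ℝ} {a b : ℝ} {μ : Measure ℝ} (h : HasLevyTriple φ a b μ) {l : ℝ}
    (hl : 0 < l) : HasDerivAt φ (b + ∫ t, t * Real.exp (-(l * t)) ∂μ) l := by
  have hs : Ioi (l / 2) ∈ 𝓝 l := Ioi_mem_nhds (by linarith)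
  have := (hasDerivAt_integral_of_dominated_loc_of_deriv_le (μ := μ)
    (F := fun l t => 1 - Real.exp (-(l * t))) (F' := fun l t => t * Real.exp (-(l * t)))
    (bound := fun t => t * Real.exp (-(l / 2 * t))) hs
    (Eventually.of_forall fun x => by fun_prop) (h.2.2.2.2 l hl).1 (by fun_prop)
    (by
      filter_upwards [aux_ae_pos h.2.2.1] with t ht x hx
      rw [Real.norm_of_nonneg (by positivity)]
      have : l / 2 ≤ x := le_of_lt hx
      gcongr)
    (aux_int1 h (half_pos hl))
    (Eventually.of_forall fun t x _ => by
      have h1 : HasDerivAt (fun x : ℝ => -(x * t)) (-t) x := by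
        exact (hasDerivAt_mul_const t).neg
      simpa [mul_comm] using h1.exp.const_sub 1)).2
  have h2 : HasDerivAt (fun l => a + b * l + ∫ t, (1 - Real.exp (-(l * t))) ∂μ)
      (b + ∫ t, t * Real.exp (-(l * t)) ∂μ) l := by
    have h3 : HasDerivAt (fun l : ℝ => a + b * l) b l := by
      simpa using ((hasDerivAt_id l).const_mul b).const_add a
    exact h3.add this
  refine h2.congr_of_eventuallyEq ?_
  filter_upwards [Ioi_mem_nhds hl] with x hx
  exact (h.2.2.2.2 x hx).2

theorem aux_d2 {φ : ℝ → ℝ} {a b : ℝ} {μ : Measure ℝ} (h : HasLevyTriple φ a b μ) {l : ℝ}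
    (hl : 0 < l) : deriv (deriv φ) l = - ∫ t, t ^ 2 * Real.exp (-(l * t)) ∂μ := by
  have hs : Ioi (l / 2) ∈ 𝓝 l := Ioi_mem_nhds (by linarith)
  have := (hasDerivAt_integral_of_dominated_loc_of_deriv_le (μ := μ)
    (F := fun l t => t * Real.exp (-(l * t))) (F' := fun l t => -(t ^ 2 * Real.exp (-(l * t))))
    (bound := fun t => t ^ 2 * Real.exp (-(l / 2 * t))) hs
    (Eventually.of_forall fun x => by fun_prop) (aux_int1 h hl) (by fun_prop)
    (by
      filter_upwards [aux_ae_pos h.2.2.1] with t ht x hx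
      rw [norm_neg, Real.norm_of_nonneg (by positivity)]
      have : l / 2 ≤ x := le_of_lt hx
      gcongr)
    (aux_int2 h (half_pos hl))
    (Eventually.of_forall fun t x _ => by
      have h1 : HasDerivAt (fun x : ℝ => -(x * t)) (-t) x := by
        exact (hasDerivAt_mul_const t).neg
      exact (h1.exp.const_mul t).congr_deriv (by ring))).2
  have h2 := this.const_add b
  rw [integral_neg] at h2
  refine (h2.congr_of_eventuallyEq ?_).deriv
  filter_upwards [Ioi_mem_nhds hl] with x hx
  exact (aux_d1 h hx).deriv

theorem aux_nonneg {φ : ℝ → ℝ} {a b : ℝ} {μ : Measure ℝ} (h : HasLevyTriple φ a b μ) {l : ℝ}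
    (hl : 0 < l) : deriv (deriv φ) l ≤ 0 := by
  rw [aux_d2 h hl, neg_nonpos]
  exact integral_nonneg fun t => by positivity

theorem aux_mono {φ : ℝ → ℝ} {a b : ℝ} {μ : Measure ℝ} (h : HasLevyTriple φ a b μ) {l l' : ℝ}
    (hl : 0 < l) (hll : l ≤ l') : deriv (deriv φ) l ≤ deriv (deriv φ) l' := by
  rw [aux_d2 h hl, aux_d2 h (hl.trans_le hll), neg_le_neg_iff]
  refine integral_mono_ae (aux_int2 h (hl.trans_le hll)) (aux_int2 h hl) ?_
  filter_upwards [aux_ae_pos h.2.2.1] with t ht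
  gcongr

theorem aux_meas_s13 {μd : ℝ → ℝ} {β : ℝ}
    (hmono : ∀ s t : ℝ, 0 < s → s ≤ t →
      Real.exp (β * t) * μd t ≤ Real.exp (β * s) * μd s) :
    AEMeasurable μd (volume.restrict (Ioi (0:ℝ))) := by
  have h1 : AEMeasurable (fun t => Real.exp (β * t) * μd t) (volume.restrict (Ioi (0:ℝ))) :=
    aemeasurable_restrict_of_antitoneOn measurableSet_Ioi
      (fun s hs t _ hst => hmono s t hs hst)
  have h2 : AEMeasurable (fun t => Real.exp (-(β * t)) * (Real.exp (β * t) * μd t))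
      (volume.restrict (Ioi (0:ℝ))) :=
    AEMeasurable.mul (by fun_prop) h1
  refine h2.congr (Eventually.of_forall fun t => ?_)
  dsimp only
  rw [← mul_assoc, ← Real.exp_add]; simp

theorem aux_neg {φ μd : ℝ → ℝ} {a b β : ℝ} {μ : Measure ℝ} (h : HasLevyTriple φ a b μ)
    (hd : HasDensity μ μd) (hmono : ∀ s t : ℝ, 0 < s → s ≤ t →
      Real.exp (β * t) * μd t ≤ Real.exp (β * s) * μd s) {l : ℝ}
    (hl : 0 < l) : deriv (deriv φ) l < 0 := by
  refine lt_of_le_of_ne (aux_nonneg h hl) ?_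
  rw [aux_d2 h hl, neg_ne_zero]
  intro h0
  rw [integral_eq_zero_iff_of_nonneg (fun t => by positivity) (aux_int2 h hl)] at h0
  have hF : ∀ᵐ t ∂μ, False := by
    filter_upwards [h0, aux_ae_pos h.2.2.1] with t h1 h2
    have : 0 < t ^ 2 * Real.exp (-(l * t)) := by positivity
    exact this.ne' h1
  have hμ : μ = 0 := by simpa using hF
  have h2 := hd.2
  rw [hμ, eq_comm, withDensity_eq_zero_iff (aux_meas_s13 hmono).ennreal_ofReal] at h2
  have h3 : ∀ᵐ t ∂(volume.restrict (Ioi (0:ℝ))), False := by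
    filter_upwards [h2, ae_restrict_mem measurableSet_Ioi] with t h4 h5
    have := hd.1 t h5
    simp at h4
    linarith
  rw [ae_iff] at h3
  simp at h3

theorem aux_main {φ μd : ℝ → ℝ} {a b β : ℝ} {μ : Measure ℝ} (h : HasLevyTriple φ a b μ)
    (hd : HasDensity μ μd) (hmono : ∀ s t : ℝ, 0 < s → s ≤ t →
      Real.exp (β * t) * μd t ≤ Real.exp (β * s) * μd s) {l x s : ℝ}
    (hβ : 0 ≤ β) (hl : β < l) (hx : 1 ≤ x) (hs : 0 < s) :
    -deriv (deriv φ) (l - β) ≤ 2 * (Real.exp (β * s) * μd s) / l ^ 3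
      + Real.exp (l * x * s) * -deriv (deriv φ) (l * x - β) := by
  have hl0 : 0 < l := by linarith
  have hlx : l ≤ l * x := by nlinarith
  have hf := (aux_meas_s13 hmono).ennreal_ofReal
  have hft : ∀ᵐ t ∂(volume.restrict (Ioi (0:ℝ))), ENNReal.ofReal (μd t) < ⊤ :=
    Eventually.of_forall fun t => ENNReal.ofReal_lt_top
  have e1 : ∫ t in Ioi (0:ℝ), t ^ 2 * Real.exp (-(l * t)) = 2 / l ^ 3 := by
    have := Real.integral_rpow_mul_exp_neg_mul_Ioi (a := 3) (r := l) (by norm_num) hl0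
    have g3 : Real.Gamma 3 = 2 := by
      have := Real.Gamma_nat_eq_factorial 2
      rw [show ((2:ℕ):ℝ) + 1 = 3 by norm_num] at this
      rw [this]; norm_num [Nat.factorial]
    rw [g3] at this
    norm_num at this
    norm_cast at this
    rw [this]; field_simp
  have i1 : Integrable (fun t : ℝ => t ^ 2 * Real.exp (-(l * t)))
      (volume.restrict (Ioi (0:ℝ))) :=
    .of_integral_ne_zero (by rw [e1]; positivity)
  have ia := aux_int2 h (c := l - β) (by linarith)
  have ib := aux_int2 h (c := l * x - β) (by linarith)
  rw [aux_d2 h (by linarith), aux_d2 h (by linarith), neg_neg, neg_neg]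
  rw [hd.2] at ia ib ⊢
  rw [integrable_withDensity_iff_integrable_smul₀' hf hft] at ia ib
  rw [integral_withDensity_eq_integral_toReal_smul₀ hf hft,
    integral_withDensity_eq_integral_toReal_smul₀ hf hft]
  have e2 : 2 * (Real.exp (β * s) * μd s) / l ^ 3 =
      ∫ t in Ioi (0:ℝ), (Real.exp (β * s) * μd s) * (t ^ 2 * Real.exp (-(l * t))) := by
    rw [integral_const_mul, e1]; ring
  rw [e2, ← integral_const_mul, ← integral_add (i1.const_mul _) (ib.const_mul _)]
  refine integral_mono_ae ia ((i1.const_mul _).add (ib.const_mul _)) ?_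
  filter_upwards [ae_restrict_mem measurableSet_Ioi] with t ht
  have ht : 0 < t := ht
  have p1 := hd.1 t ht
  have p2 := hd.1 s hs
  simp only [smul_eq_mul, ENNReal.toReal_ofReal p1.le]
  rcases le_total s t with hst | hst
  · have q := hmono s t hs hst
    have q1 : Real.exp (-((l - β) * t)) = Real.exp (β * t) * Real.exp (-(l * t)) := by
      rw [← Real.exp_add]; ring_nf
    rw [q1]
    have : μd t * (t ^ 2 * (Real.exp (β * t) * Real.exp (-(l * t))))
        ≤ Real.exp (β * s) * μd s * (t ^ 2 * Real.exp (-(l * t))) := by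
      calc _ = Real.exp (β * t) * μd t * (t ^ 2 * Real.exp (-(l * t))) := by ring
        _ ≤ _ := by gcongr
    have : 0 ≤ Real.exp (l * x * s) * (μd t * (t ^ 2 * Real.exp (-((l * x - β) * t)))) := by
      positivity
    linarith
  · have : μd t * (t ^ 2 * Real.exp (-((l - β) * t))) ≤
        Real.exp (l * x * s) * (μd t * (t ^ 2 * Real.exp (-((l * x - β) * t)))) := by
      have q1 : Real.exp (-((l - β) * t)) ≤
          Real.exp (l * x * s) * Real.exp (-((l * x - β) * t)) := by
        rw [← Real.exp_add]
        apply Real.exp_le_exp.2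
        have : l * x * t ≤ l * x * s := by
          have : 0 ≤ l * x := by linarith
          gcongr
        nlinarith
      calc _ ≤ μd t * (t ^ 2 * (Real.exp (l * x * s) * Real.exp (-((l * x - β) * t)))) := by
            gcongr
        _ = _ := by ring
    have : 0 ≤ Real.exp (β * s) * μd s * (t ^ 2 * Real.exp (-(l * t))) := by positivity
    linarith

theorem aux_bern_diff {φ : ℝ → ℝ} (hφ : Bernstein φ) (n : ℕ) {x : ℝ} (hx : 0 < x) :
    DifferentiableAt ℝ (iteratedDeriv n φ) x := by
  have h1 := (hφ.1.differentiableOn_iteratedDerivWithin (m := n)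
    (by exact_mod_cast ENat.natCast_lt_top n) isOpen_Ioi.uniqueDiffOn).differentiableAt
    (Ioi_mem_nhds hx)
  refine h1.congr_of_eventuallyEq ?_
  filter_upwards [Ioi_mem_nhds hx] with y hy
  exact (iteratedDerivWithin_of_isOpen isOpen_Ioi hy).symm

theorem aux_bern_bound {φ : ℝ → ℝ} (hφ : Bernstein φ) (hD : DerivsFinite (deriv φ)) (n : ℕ)
    {x : ℝ} (hx : 0 < x) : |iteratedDeriv (n + 1) φ x| ≤ |dplus φ (n + 1)| := by
  have hT : Tendsto (iteratedDeriv (n + 1) φ) (𝓝[>] 0) (𝓝 (dplus φ (n + 1))) := by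
    have := hD n
    unfold dplus at this ⊢
    rwa [iteratedDeriv_succ']
  have hanti : AntitoneOn (fun x => (-1 : ℝ) ^ n * iteratedDeriv (n + 1) φ x) (Ioi 0) := by
    refine antitoneOn_of_deriv_nonpos (convex_Ioi 0) ?_ ?_ ?_
    · intro y hy
      exact ((aux_bern_diff hφ (n + 1) hy).const_mul _).continuousAt.continuousWithinAt
    · intro y hy
      rw [interior_Ioi] at hy
      exact ((aux_bern_diff hφ (n + 1) hy).const_mul _).differentiableWithinAt
    · intro y hy
      rw [interior_Ioi] at hy
      rw [deriv_const_mul _ (aux_bern_diff hφ (n + 1) hy), ← iteratedDeriv_succ]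
      have := hφ.2.2 (n + 1) y hy
      rw [pow_succ] at this
      linarith
  have hle : (-1 : ℝ) ^ n * iteratedDeriv (n + 1) φ x ≤ (-1 : ℝ) ^ n * dplus φ (n + 1) := by
    refine ge_of_tendsto (hT.const_mul _) ?_
    filter_upwards [Ioo_mem_nhdsGT hx] with y hy
    exact hanti hy.1 hx hy.2.le
  have h0 := hφ.2.2 n x hx
  have e : ∀ z : ℝ, |z| = |(-1 : ℝ) ^ n * z| := by
    intro z; simp [abs_mul]
  rw [e, e (dplus φ (n + 1))]
  exact abs_le_abs_of_nonneg h0 hle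

theorem aux_bern_zero {φ : ℝ → ℝ} (hφ : Bernstein φ) :
    Tendsto φ (𝓝[>] 0) (𝓝 (dplus φ 0)) := by
  have hm : MonotoneOn φ (Ioi 0) := by
    have hd : ∀ y : ℝ, 0 < y → DifferentiableAt ℝ φ y := fun y hy => by
      simpa using aux_bern_diff hφ 0 hy
    refine monotoneOn_of_deriv_nonneg (convex_Ioi 0) ?_ ?_ ?_
    · intro y hy
      exact (hd y hy).continuousAt.continuousWithinAt
    · intro y hy
      rw [interior_Ioi] at hy
      exact (hd y hy).differentiableWithinAt
    · intro y hy
      rw [interior_Ioi] at hy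
      simpa using hφ.2.2 0 y hy
  have hb : BddBelow (φ '' Ioi 0) := ⟨0, by rintro _ ⟨y, hy, rfl⟩; exact hφ.2.1 y hy⟩
  have := hm.tendsto_nhdsGT hb
  unfold dplus
  rw [iteratedDeriv_zero]
  exact tendsto_nhds_limUnder ⟨_, this⟩

theorem aux_taylor_s13 {φ : ℝ → ℝ} (hφ : Bernstein φ) (hD : DerivsFinite (deriv φ)) {r R : ℝ}
    (hr : 0 < r) (hrR : r < R) (hS : Summable (tser (deriv φ) (-R))) :
    φ r = ∑' n : ℕ, dplus φ n / (n.factorial : ℝ) * r ^ n := by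
  have hsucc : ∀ n, dplus φ (n + 1) = dplus (deriv φ) n := by
    intro n; unfold dplus; rw [iteratedDeriv_succ']
  have hT : ∀ n, Tendsto (iteratedDeriv n φ) (𝓝[>] 0) (𝓝 (dplus φ n)) := by
    intro n
    cases n with
    | zero => rw [iteratedDeriv_zero]; exact aux_bern_zero hφ
    | succ n =>
      have := hD n
      rw [hsucc, iteratedDeriv_succ']
      exact this
  have hu : Summable (fun n : ℕ => |dplus φ n / (n.factorial : ℝ) * r ^ n|) := by
    rw [← summable_nat_add_iff 1]
    refine Summable.of_nonneg_of_le (fun n => abs_nonneg _) (fun n => ?_) (hS.abs.mul_left r)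
    unfold tser
    rw [hsucc, neg_neg]
    simp only [abs_mul, abs_div, abs_pow, Nat.abs_cast, abs_of_pos hr, abs_of_pos (hr.trans hrR)]
    have h1 : (n.factorial : ℝ) ≤ ((n + 1).factorial : ℝ) := by
      exact_mod_cast Nat.factorial_le (Nat.le_succ n)
    have h2 : r ^ n ≤ R ^ n := by gcongr
    calc |dplus (deriv φ) n| / ((n + 1).factorial : ℝ) * r ^ (n + 1)
        = r * (|dplus (deriv φ) n| / ((n + 1).factorial : ℝ) * r ^ n) := by ring
      _ ≤ r * (|dplus (deriv φ) n| / (n.factorial : ℝ) * R ^ n) := by gcongr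
  have hkey : ∀ n : ℕ,
      |φ r - ∑ k ∈ Finset.range (n + 1), dplus φ k / (k.factorial : ℝ) * r ^ k| ≤
      |dplus φ (n + 1) / ((n + 1).factorial : ℝ) * r ^ (n + 1)| := by
    intro n
    have hlim : Tendsto (fun ε : ℝ => |φ r - ∑ k ∈ Finset.range (n + 1),
        ((k.factorial : ℝ)⁻¹ * (r - ε) ^ k) * iteratedDeriv k φ ε|) (𝓝[>] 0)
        (𝓝 |φ r - ∑ k ∈ Finset.range (n + 1), ((k.factorial : ℝ)⁻¹ * (r - 0) ^ k) * dplus φ k|) := by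
      refine (Tendsto.sub tendsto_const_nhds (tendsto_finsetSum _ fun k _ => ?_)).abs
      refine Tendsto.mul ?_ (hT k)
      have : Continuous (fun ε : ℝ => (k.factorial : ℝ)⁻¹ * (r - ε) ^ k) := by fun_prop
      exact this.continuousAt.tendsto.mono_left nhdsWithin_le_nhds
    have e : ∑ k ∈ Finset.range (n + 1), dplus φ k / (k.factorial : ℝ) * r ^ k =
        ∑ k ∈ Finset.range (n + 1), ((k.factorial : ℝ)⁻¹ * (r - 0) ^ k) * dplus φ k := by
      refine Finset.sum_congr rfl fun k _ => ?_
      rw [sub_zero]; ring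
    rw [e]
    refine le_of_tendsto hlim ?_
    filter_upwards [Ioo_mem_nhdsGT hr] with ε hε
    have hε0 : 0 < ε := hε.1
    have hεr : ε < r := hε.2
    have hsub : uIcc ε r ⊆ Ioi 0 := by
      rw [uIcc_of_le hεr.le]
      intro y hy
      exact hε0.trans_le hy.1
    obtain ⟨y, hy, hyeq⟩ := taylor_mean_remainder_lagrange_iteratedDeriv (f := φ) (n := n)
      hεr.ne ((hφ.1.mono hsub).of_le (by exact_mod_cast le_top))
    rw [taylor_within_apply] at hyeq
    have hy0 : 0 < y := hsub (uIoo_subset_uIcc_self hy)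
    have e2 : ∑ k ∈ Finset.range (n + 1),
        ((k.factorial : ℝ)⁻¹ * (r - ε) ^ k) • iteratedDerivWithin k φ (uIcc ε r) ε =
        ∑ k ∈ Finset.range (n + 1), ((k.factorial : ℝ)⁻¹ * (r - ε) ^ k) * iteratedDeriv k φ ε := by
      refine Finset.sum_congr rfl fun k _ => ?_
      rw [smul_eq_mul, iteratedDerivWithin_eq_iteratedDeriv (uniqueDiffOn_uIcc hεr.ne) _
        left_mem_uIcc]
      exact (hφ.1.contDiffAt (Ioi_mem_nhds hε0)).of_le (by exact_mod_cast le_top)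
    rw [e2] at hyeq
    rw [hyeq]
    have hb := aux_bern_bound hφ hD n hy0
    have h3 : 0 ≤ r - ε := by linarith
    have h4 : (r - ε) ^ (n + 1) ≤ r ^ (n + 1) := by gcongr; linarith
    simp only [abs_mul, abs_div, abs_pow, Nat.abs_cast, abs_of_pos hr, abs_of_nonneg h3]
    rw [div_mul_eq_mul_div]
    gcongr
  have hs1 : Tendsto (fun n => ∑ k ∈ Finset.range (n + 1), dplus φ k / (k.factorial : ℝ) * r ^ k)
      atTop (𝓝 (∑' n : ℕ, dplus φ n / (n.factorial : ℝ) * r ^ n)) :=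
    (tendsto_add_atTop_iff_nat 1).2 hu.of_abs.hasSum.tendsto_sum_nat
  have hs2 : Tendsto (fun n : ℕ => |dplus φ (n + 1) / ((n + 1).factorial : ℝ) * r ^ (n + 1)|)
      atTop (𝓝 0) := (tendsto_add_atTop_iff_nat 1).2 hu.tendsto_atTop_zero
  have hs3 : Tendsto (fun n => φ r - ∑ k ∈ Finset.range (n + 1),
      dplus φ k / (k.factorial : ℝ) * r ^ k) atTop (𝓝 0) :=
    squeeze_zero_norm hkey hs2
  have := tendsto_nhds_unique hs3 (tendsto_const_nhds.sub hs1)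
  linarith

theorem aux_reflect {φ φe : ℝ → ℝ} {β : ℝ} (hφ : Bernstein φ)
    (hβ : IsAbscissa (deriv φ) (-β))
    (hφe : ∀ l : ℝ, -β < l → l ≤ 0 →
        φe l = ∑' n : ℕ, dplus φ n / (n.factorial : ℝ) * (-l) ^ n)
    {l : ℝ} (h1 : -β < l) (h2 : l < 0) :
    deriv (deriv φe) l = deriv (deriv φ) (-l) := by
  have hD : DerivsFinite (deriv φ) := by
    by_contra h
    have := hβ.2 h
    linarith
  have hglb := hβ.1 hD
  have heq : ∀ x ∈ Ioo (-β) 0, φe x = φ (-x) := by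
    intro x hx
    rw [hφe x hx.1 hx.2.le]
    obtain ⟨c, hc, hc1, hc2⟩ := hglb.exists_between hx.1
    refine (aux_taylor_s13 hφ hD (R := -c) (by linarith [hx.2]) (by linarith) ?_).symm
    rw [neg_neg]
    exact hc
  have hd : ∀ x ∈ Ioo (-β) 0, deriv φe x = -deriv φ (-x) := by
    intro x hx
    have : φe =ᶠ[𝓝 x] fun y => φ (-y) := by
      filter_upwards [Ioo_mem_nhds hx.1 hx.2] with y hy using heq y hy
    rw [this.deriv_eq, deriv_comp_neg]
  have : deriv φe =ᶠ[𝓝 l] fun y => -deriv φ (-y) := by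
    filter_upwards [Ioo_mem_nhds h1 h2] with y hy using hd y hy
  rw [this.deriv_eq, deriv.fun_neg, deriv_comp_neg, neg_neg]

theorem aux_ext {φ φe : ℝ → ℝ} (h : ∀ l : ℝ, 0 < l → φe l = φ l) {l : ℝ} (hl : 0 < l) :
    deriv (deriv φe) l = deriv (deriv φ) l := by
  have : φe =ᶠ[𝓝 l] φ := by
    filter_upwards [Ioi_mem_nhds hl] with y hy using h y hy
  exact this.deriv.deriv_eq

/-- Corollary 4.1(ii): under the assumptions of Corollary 4.1(i) and the scaling condition
`φ_e''(λx-β)/φ_e''(λ-β) ≤ θ x^{-γ}` for `x ≥ 1`, `λ ∈ (Λ₁,Λ₂)`, there are `c₂ > 0` and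
`δ ∈ (0,1)` with `μd t ≥ -c₂ t^{-3} φ_e''(t⁻¹-β) e^{-β t}` for `t ∈ (δΛ₂⁻¹, δΛ₁⁻¹)`. -/
theorem stmt_13 (φ φe μd : ℝ → ℝ) (a b : ℝ) (μmeas : MeasureTheory.Measure ℝ)
    (β θ γ : ℝ) (Λ₁ Λ₂ : ENNReal)
    (hφ : Bernstein φ) (htriple : HasLevyTriple φ a b μmeas)
    (hβ : IsAbscissa (deriv φ) (-β))
    (hμd : HasDensity μmeas μd)
    (hmono : ∀ s t : ℝ, 0 < s → s ≤ t →
      Real.exp (β * t) * μd t ≤ Real.exp (β * s) * μd s)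
    (hφe : (∀ l : ℝ, 0 < l → φe l = φ l) ∧
      (∀ l : ℝ, -β < l → l ≤ 0 →
        φe l = ∑' n : ℕ, dplus φ n / (n.factorial : ℝ) * (-l) ^ n))
    (hθ : 0 < θ) (hγ : 0 < γ) (hΛ : Λ₁ < Λ₂)
    (hA3 : ∀ x l : ℝ, 1 ≤ x → Λ₁ < ENNReal.ofReal l → ENNReal.ofReal l < Λ₂ →
      deriv (deriv φe) (l * x - β) / deriv (deriv φe) (l - β) ≤ θ * x ^ (-γ)) :
    ∃ c₂ δ : ℝ, 0 < c₂ ∧ 0 < δ ∧ δ < 1 ∧ ∀ t : ℝ,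
      ENNReal.ofReal δ * Λ₂⁻¹ < ENNReal.ofReal t →
      ENNReal.ofReal t < ENNReal.ofReal δ * Λ₁⁻¹ →
      -c₂ * deriv (deriv φe) (t⁻¹ - β) * Real.exp (-(β * t)) / t ^ 3 ≤ μd t := by
  have hβ0 : 0 ≤ β := by
    by_cases hD : DerivsFinite (deriv φ)
    · have h0 : (0:ℝ) ∈ {l : ℝ | Summable (tser (deriv φ) l)} := by
        refine summable_of_ne_finset_zero (s := {0}) fun n hn => ?_
        have : n ≠ 0 := by simpa using hn
        simp [tser, this]
      have := (hβ.1 hD).1 h0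
      linarith
    · have := hβ.2 hD
      linarith
  have hext : ∀ l : ℝ, 0 < l → deriv (deriv φe) l = deriv (deriv φ) l :=
    fun l hl => aux_ext hφe.1 hl
  have hneg : ∀ l : ℝ, 0 < l → deriv (deriv φ) l < 0 := fun l hl => aux_neg htriple hμd hmono hl
  by_cases hcase : 0 < β ∧ Λ₁ = 0
  · exfalso
    obtain ⟨hβp, rfl⟩ := hcase
    have hκ : 0 < deriv (deriv φ) β / deriv (deriv φ) (β / 2) :=
      div_pos_of_neg_of_neg (hneg _ hβp) (hneg _ (by linarith))
    have t1 : Tendsto (fun x : ℝ => θ * x ^ (-γ)) atTop (𝓝 0) := by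
      simpa using (tendsto_rpow_neg_atTop hγ).const_mul θ
    have t2 : Tendsto (fun x : ℝ => ENNReal.ofReal (2 * β / x)) atTop (𝓝 0) := by
      have : Tendsto (fun x : ℝ => 2 * β / x) atTop (𝓝 0) :=
        tendsto_const_nhds.div_atTop tendsto_id
      simpa using ENNReal.tendsto_ofReal this
    obtain ⟨x, h1, h2, h3⟩ := ((t1.eventually_lt_const hκ).and
      ((t2.eventually_lt_const hΛ).and (eventually_gt_atTop 4))).exists
    have hx0 : 0 < x := by linarith
    have hl0 : 0 < 2 * β / x := by positivity
    have hl2 : 2 * β / x < β / 2 := by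
      rw [div_lt_iff₀ hx0]; nlinarith
    have h4 := hA3 x (2 * β / x) (by linarith) (by simpa using hl0) h2
    have e1 : 2 * β / x * x - β = β := by field_simp; ring
    rw [e1, hext β hβp, aux_reflect hφ hβ hφe.2 (by linarith) (by linarith)] at h4
    have h5 := aux_mono htriple (l := β / 2) (l' := -(2 * β / x - β)) (by linarith) (by linarith)
    have h6 := hneg (-(2 * β / x - β)) (by linarith)
    have h7 := hneg β hβp
    have h8 : deriv (deriv φ) β / deriv (deriv φ) (β / 2) ≤
        deriv (deriv φ) β / deriv (deriv φ) (-(2 * β / x - β)) := by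
      rw [← neg_div_neg_eq, ← neg_div_neg_eq (deriv (deriv φ) β)]
      apply div_le_div_of_nonneg_left <;> linarith
    linarith
  · have hΛ1top : Λ₁ ≠ ⊤ := hΛ.ne_top
    obtain ⟨x, hx2, hxe, hxL⟩ : ∃ x : ℝ, 2 ≤ x ∧ Real.exp 1 * (θ * x ^ (-γ)) ≤ 1 / 2 ∧
        2 * β ≤ x * Λ₁.toReal := by
      have t1 : Tendsto (fun x : ℝ => Real.exp 1 * (θ * x ^ (-γ))) atTop (𝓝 0) := by
        simpa using ((tendsto_rpow_neg_atTop hγ).const_mul θ).const_mul (Real.exp 1)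
      have t2 : ∀ᶠ x : ℝ in atTop, 2 * β ≤ x * Λ₁.toReal := by
        rcases hβ0.eq_or_lt with h | h
        · filter_upwards [eventually_ge_atTop 0] with x hx
          rw [← h]
          have := mul_nonneg hx (ENNReal.toReal_nonneg (a := Λ₁))
          linarith
        · have hL : 0 < Λ₁.toReal := ENNReal.toReal_pos (fun h0 => hcase ⟨h, h0⟩) hΛ1top
          exact (tendsto_id.atTop_mul_const hL).eventually_ge_atTop (2 * β)
      obtain ⟨x, h1, h2, h3⟩ := ((eventually_ge_atTop (2:ℝ)).and
        ((t1.eventually_le_const (by norm_num : (0:ℝ) < 1 / 2)).and t2)).exists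
      exact ⟨x, h1, h2, h3⟩
    have hx0 : 0 < x := by linarith
    obtain ⟨δ, hδ⟩ : ∃ δ : ℝ, δ = 1 / x := ⟨_, rfl⟩
    have hδ0 : 0 < δ := by rw [hδ]; positivity
    have hδ1 : δ < 1 := by rw [hδ, div_lt_one hx0]; linarith
    have hδx : δ * x = 1 := by rw [hδ]; field_simp
    have hrange : ∀ t : ℝ, ENNReal.ofReal δ * Λ₂⁻¹ < ENNReal.ofReal t →
        ENNReal.ofReal t < ENNReal.ofReal δ * Λ₁⁻¹ →
        0 < t ∧ Λ₁ < ENNReal.ofReal (δ / t) ∧ ENNReal.ofReal (δ / t) < Λ₂ := by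
      intro t h1 h2
      have ht : 0 < t := ENNReal.ofReal_pos.1 (pos_of_gt h1)
      have htE : ENNReal.ofReal t ≠ 0 := (ENNReal.ofReal_pos.2 ht).ne'
      have hdE : ENNReal.ofReal δ ≠ 0 := (ENNReal.ofReal_pos.2 hδ0).ne'
      refine ⟨ht, ?_, ?_⟩
      · rw [ENNReal.ofReal_div_of_pos ht,
          ENNReal.lt_div_iff_mul_lt (Or.inl htE) (Or.inl ENNReal.ofReal_ne_top), mul_comm]
        rwa [← div_eq_mul_inv, ENNReal.lt_div_iff_mul_lt (Or.inr ENNReal.ofReal_ne_top)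
          (Or.inr htE)] at h2
      · rw [ENNReal.ofReal_div_of_pos ht,
          ENNReal.div_lt_iff (Or.inl htE) (Or.inl ENNReal.ofReal_ne_top)]
        rwa [← div_eq_mul_inv, ENNReal.div_lt_iff (Or.inr hdE)
          (Or.inr ENNReal.ofReal_ne_top), mul_comm] at h1
    -- region where `δ / t > β`
    have hC1 : ∀ t : ℝ, 0 < t → Λ₁ < ENNReal.ofReal (δ / t) → ENNReal.ofReal (δ / t) < Λ₂ →
        β * t < δ → 0 < t⁻¹ - β ∧
        δ ^ 3 / 4 * (-deriv (deriv φ) (t⁻¹ - β)) / t ^ 3 ≤ Real.exp (β * t) * μd t := by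
      intro t ht h1 h2 h3
      have hl : β < δ / t := by rwa [lt_div_iff₀ ht]
      have hlx : δ / t * x = t⁻¹ := by
        rw [div_mul_eq_mul_div, hδx, one_div]
      have hle : δ / t ≤ t⁻¹ := by
        rw [← one_div]; gcongr
      have hm := aux_main htriple hμd hmono hβ0 hl (by linarith : 1 ≤ x) ht
      have hA := hA3 x (δ / t) (by linarith) h1 h2
      rw [hlx] at hm hA
      rw [inv_mul_cancel₀ ht.ne'] at hm
      rw [hext _ (by linarith), hext _ (by linarith)] at hA
      have hn1 := hneg (δ / t - β) (by linarith)
      have hmon := aux_mono htriple (l := δ / t - β) (l' := t⁻¹ - β) (by linarith) (by linarith)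
      rw [← neg_div_neg_eq, div_le_iff₀ (by linarith)] at hA
      have hB : Real.exp 1 * -deriv (deriv φ) (t⁻¹ - β) ≤
          1 / 2 * -deriv (deriv φ) (δ / t - β) := by
        calc _ ≤ Real.exp 1 * (θ * x ^ (-γ) * -deriv (deriv φ) (δ / t - β)) := by gcongr
          _ = Real.exp 1 * (θ * x ^ (-γ)) * -deriv (deriv φ) (δ / t - β) := by ring
          _ ≤ _ := by
            apply mul_le_mul_of_nonneg_right hxe; linarith
      refine ⟨by linarith, ?_⟩
      have hC : -deriv (deriv φ) (δ / t - β) ≤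
          4 * (Real.exp (β * t) * μd t) / (δ / t) ^ 3 := by
        have : 4 * (Real.exp (β * t) * μd t) / (δ / t) ^ 3 =
          2 * (2 * (Real.exp (β * t) * μd t) / (δ / t) ^ 3) := by ring
        rw [this]; linarith
      rw [le_div_iff₀ (by positivity)] at hC
      have hD : -deriv (deriv φ) (t⁻¹ - β) * (δ / t) ^ 3 ≤
          -deriv (deriv φ) (δ / t - β) * (δ / t) ^ 3 := by
        gcongr
      have e : δ ^ 3 / 4 * (-deriv (deriv φ) (t⁻¹ - β)) / t ^ 3 =
          (-deriv (deriv φ) (t⁻¹ - β) * (δ / t) ^ 3) / 4 := by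
        rw [div_pow]; ring
      rw [e]; linarith
    -- region where `δ / t ≤ β`
    have hC2 : ∃ K : ℝ, 0 < K ∧ ∀ t : ℝ, 0 < t → Λ₁ < ENNReal.ofReal (δ / t) → δ ≤ β * t →
        0 < t⁻¹ - β ∧
        K * (-deriv (deriv φ) (t⁻¹ - β)) / t ^ 3 ≤ Real.exp (β * t) * μd t := by
      rcases hβ0.eq_or_lt with h | h
      · refine ⟨1, one_pos, fun t ht _ h3 => ?_⟩
        rw [← h] at h3
        linarith
      · have hL : 0 < Λ₁.toReal := ENNReal.toReal_pos (fun h0 => hcase ⟨h, h0⟩) hΛ1top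
        have hG := hneg β h
        have hm0 : 0 < μd (δ / Λ₁.toReal) := hμd.1 _ (by positivity)
        have hden : 0 < -deriv (deriv φ) β * (β / δ) ^ 3 := by
          have : 0 < -deriv (deriv φ) β := by linarith
          positivity
        refine ⟨Real.exp (β * (δ / Λ₁.toReal)) * μd (δ / Λ₁.toReal) /
          (-deriv (deriv φ) β * (β / δ) ^ 3), by positivity, fun t ht h1 h3 => ?_⟩
        have hLt : Λ₁.toReal < δ / t := (ENNReal.lt_ofReal_iff_toReal_lt hΛ1top).1 h1
        have hlx : δ / t * x = t⁻¹ := by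
          rw [div_mul_eq_mul_div, hδx, one_div]
        have h4 : 2 * β < t⁻¹ := by
          rw [← hlx]; nlinarith
        have h5 : t ≤ δ / Λ₁.toReal := by
          rw [lt_div_iff₀ ht] at hLt
          rw [le_div_iff₀ hL]; linarith
        have h6 := hmono t _ ht h5
        have h7 := aux_mono htriple (l := β) (l' := t⁻¹ - β) h (by linarith)
        have h8 : t⁻¹ ≤ β / δ := by
          rw [inv_eq_one_div, div_le_div_iff₀ ht hδ0]; linarith
        have h9 := hneg (t⁻¹ - β) (by linarith)
        refine ⟨by linarith, le_trans ?_ h6⟩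
        have h10 : -deriv (deriv φ) (t⁻¹ - β) * t⁻¹ ^ 3 ≤
            -deriv (deriv φ) β * (β / δ) ^ 3 := by
          have : 0 ≤ -deriv (deriv φ) β := by linarith
          gcongr
        rw [mul_div_assoc, div_mul_eq_mul_div, div_le_iff₀ hden, div_eq_mul_inv _ (t ^ 3),
          ← inv_pow]
        gcongr
    obtain ⟨K, hK, hC2⟩ := hC2
    refine ⟨min (δ ^ 3 / 4) K, δ, by positivity, hδ0, hδ1, fun t h1 h2 => ?_⟩
    obtain ⟨ht, h3, h4⟩ := hrange t h1 h2
    have hfin : 0 < t⁻¹ - β ∧ min (δ ^ 3 / 4) K * (-deriv (deriv φ) (t⁻¹ - β)) / t ^ 3 ≤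
        Real.exp (β * t) * μd t := by
      rcases lt_or_ge (β * t) δ with h5 | h5
      · obtain ⟨h6, h7⟩ := hC1 t ht h3 h4 h5
        refine ⟨h6, le_trans ?_ h7⟩
        have h8 : 0 ≤ -deriv (deriv φ) (t⁻¹ - β) := by linarith [hneg _ h6]
        gcongr
        exact min_le_left _ _
      · obtain ⟨h6, h7⟩ := hC2 t ht h3 h5
        refine ⟨h6, le_trans ?_ h7⟩
        have h8 : 0 ≤ -deriv (deriv φ) (t⁻¹ - β) := by linarith [hneg _ h6]
        gcongr
        exact min_le_right _ _
    obtain ⟨h6, h7⟩ := hfin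
    rw [hext _ h6]
    have e : Real.exp (-(β * t)) * (Real.exp (β * t) * μd t) = μd t := by
      rw [← mul_assoc, ← Real.exp_add]; simp
    rw [← e]
    calc _ = Real.exp (-(β * t)) *
          (min (δ ^ 3 / 4) K * (-deriv (deriv φ) (t⁻¹ - β)) / t ^ 3) := by ring
      _ ≤ _ := by gcongr
end

section
/- Let a ≥ 0, c > 0 and let f:(0,∞)→(0,∞) be non-increasing with t ↦ t² f(t) non-decreasing. Define F(r) := ∫_0^∞ t^{−a} e^{−r²/(c²t)} f(t) dt for r > 0. If a ≤ 1, assume additionally that there exist constants c′ > 0, γ′ > 1 − a and R ≥ 0 such that f(tx)/f(t) ≤ c′ x^{−γ′} for all t > R and all x ≥ 1, and set R₀ := √R; if a > 1 set R₀ := 0. Then there exist constants 0 < c₁ ≤ c₂ such that c₁ r^{−2a+2} f(r²) ≤ F(r) ≤ c₂ r^{−2a+2} f(r²) for all r > R₀. -/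
open MeasureTheory Filter Set Topology


lemma aux_M (a c : ℝ) (hc : 0 < c) : ∃ M : ℝ, 0 < M ∧ ∀ s : ℝ, 0 < s → s ≤ 1 →
    s ^ (-a) * Real.exp (-(1 / (c ^ 2 * s))) * (s ^ 2)⁻¹ ≤ M := by
  obtain ⟨n, hn⟩ := exists_nat_ge (a + 2)
  refine ⟨n.factorial * (c ^ 2) ^ n, by positivity, fun s hs hs1 => ?_⟩
  have hy : 0 < 1 / (c ^ 2 * s) := by positivity
  have h1 := Real.pow_div_factorial_le_exp (1 / (c ^ 2 * s)) hy.le n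
  have h2 : s ^ (-a) * (s ^ 2)⁻¹ ≤ (s ^ n)⁻¹ := by
    have e1 : s ^ (-a) * (s ^ 2)⁻¹ = s ^ (-a - 2) := by
      rw [Real.rpow_sub hs, div_eq_mul_inv]; norm_num
    have e2 : (s ^ n)⁻¹ = s ^ (-(n : ℝ)) := by
      rw [Real.rpow_neg hs.le, Real.rpow_natCast]
    rw [e1, e2]
    exact Real.rpow_le_rpow_of_exponent_ge hs hs1 (by linarith)
  have h3 : Real.exp (-(1 / (c ^ 2 * s))) ≤ n.factorial * (c ^ 2) ^ n * s ^ n := by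
    rw [Real.exp_neg]
    have : (n.factorial * (c ^ 2) ^ n * s ^ n : ℝ) = ((1 / (c ^ 2 * s)) ^ n / n.factorial)⁻¹ := by
      rw [div_pow, mul_pow, one_pow]; field_simp
    rw [this]
    exact inv_anti₀ (by positivity) h1
  calc s ^ (-a) * Real.exp (-(1 / (c ^ 2 * s))) * (s ^ 2)⁻¹
      = (s ^ (-a) * (s ^ 2)⁻¹) * Real.exp (-(1 / (c ^ 2 * s))) := by ring
    _ ≤ (s ^ n)⁻¹ * (n.factorial * (c ^ 2) ^ n * s ^ n) := by gcongr
    _ = _ := by field_simp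

lemma aux_main_s19 (a c D γ : ℝ) (f : ℝ → ℝ) (ha : 0 ≤ a) (hc : 0 < c) (hD : 0 < D)
    (hγ : 1 - a < γ)
    (hfpos : ∀ t : ℝ, 0 < t → 0 < f t)
    (hmono : ∀ s t : ℝ, 0 < s → s ≤ t → f t ≤ f s)
    (hmono2 : ∀ s t : ℝ, 0 < s → s ≤ t → s ^ 2 * f s ≤ t ^ 2 * f t) :
    ∃ c₁ c₂ : ℝ, 0 < c₁ ∧ c₁ ≤ c₂ ∧ ∀ r : ℝ, 0 < r →
      (∀ x : ℝ, 1 ≤ x → f (r ^ 2 * x) ≤ D * x ^ (-γ) * f (r ^ 2)) →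
      c₁ * (r ^ (-2 * a + 2) * f (r ^ 2)) ≤ (∫ t in Set.Ioi (0:ℝ),
        t ^ (-a) * Real.exp (-(r ^ 2 / (c ^ 2 * t))) * f t) ∧
      (∫ t in Set.Ioi (0:ℝ),
        t ^ (-a) * Real.exp (-(r ^ 2 / (c ^ 2 * t))) * f t)
        ≤ c₂ * (r ^ (-2 * a + 2) * f (r ^ 2)) := by
  obtain ⟨M, hM, hMs⟩ := aux_M a c hc
  set K : ℝ → ℝ := fun s => if s ≤ 1 then M else D * s ^ (-a - γ) with hK
  have hKint : IntegrableOn K (Ioi 0) := by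
    rw [← Ioc_union_Ioi_eq_Ioi (zero_le_one' ℝ)]
    refine IntegrableOn.union ?_ ?_
    · refine IntegrableOn.congr_fun (f := fun _ => M) (by simp) ?_ measurableSet_Ioc
      intro x hx; simp [hK, hx.2]
    · refine IntegrableOn.congr_fun (f := fun s => D * s ^ (-a - γ)) ?_ ?_ measurableSet_Ioi
      · exact (integrableOn_Ioi_rpow_of_lt (by linarith) one_pos).const_mul D
      · intro x hx; simp [hK, not_le.mpr (mem_Ioi.mp hx)]
  set c₁ : ℝ := (2:ℝ) ^ (-a) * Real.exp (-(1 / c ^ 2)) * (1 / 4) with hc₁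
  refine ⟨c₁, max c₁ (∫ s in Ioi (0:ℝ), K s), by positivity, le_max_left _ _, fun r hr hx => ?_⟩
  have hr2 : 0 < r ^ 2 := by positivity
  have hf0 := hfpos _ hr2
  set G : ℝ → ℝ := fun s => s ^ (-a) * Real.exp (-(1 / (c ^ 2 * s))) * f (r ^ 2 * s) with hG
  have hsub : (∫ t in Set.Ioi (0:ℝ), t ^ (-a) * Real.exp (-(r ^ 2 / (c ^ 2 * t))) * f t)
      = r ^ (-2 * a + 2) * ∫ s in Ioi (0:ℝ), G s := by
    have h := integral_comp_mul_left_Ioi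
      (fun t => t ^ (-a) * Real.exp (-(r ^ 2 / (c ^ 2 * t))) * f t) 0 hr2
    rw [mul_zero, smul_eq_mul, eq_inv_mul_iff_mul_eq₀ hr2.ne'] at h
    rw [← h, Real.rpow_add hr, Real.rpow_two, mul_comm (r ^ (-2 * a)), mul_assoc]
    congr 1
    rw [← integral_const_mul]
    refine setIntegral_congr_fun measurableSet_Ioi fun s hs => ?_
    have hs : 0 < s := hs
    have e1 : (r ^ 2 * s) ^ (-a) = r ^ (-2 * a) * s ^ (-a) := by
      rw [Real.mul_rpow hr2.le hs.le, ← Real.rpow_natCast, ← Real.rpow_mul hr.le]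
      norm_num
    have e2 : r ^ 2 / (c ^ 2 * (r ^ 2 * s)) = 1 / (c ^ 2 * s) := by field_simp
    simp only [hG, e1, e2]; ring
  have hGnn : ∀ s, 0 < s → 0 ≤ G s := fun s hs => by
    have := hfpos (r ^ 2 * s) (by positivity)
    simp only [hG]; positivity
  have hGK : ∀ s, 0 < s → G s ≤ K s * f (r ^ 2) := fun s hs => by
    have hfs := hfpos (r ^ 2 * s) (by positivity)
    by_cases h1 : s ≤ 1
    · have h2 := hmono2 (r ^ 2 * s) (r ^ 2) (by positivity) (by nlinarith)
      have h3 : f (r ^ 2 * s) ≤ (s ^ 2)⁻¹ * f (r ^ 2) := by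
        rw [inv_mul_eq_div, le_div_iff₀ (by positivity)]
        have : 0 < (r ^ 2) ^ 2 := by positivity
        refine le_of_mul_le_mul_left ?_ this
        linarith
      simp only [hG, hK, h1, if_true]
      calc _ ≤ s ^ (-a) * Real.exp (-(1 / (c ^ 2 * s))) * ((s ^ 2)⁻¹ * f (r ^ 2)) := by gcongr
        _ = s ^ (-a) * Real.exp (-(1 / (c ^ 2 * s))) * (s ^ 2)⁻¹ * f (r ^ 2) := by ring
        _ ≤ _ := by gcongr; exact hMs s hs h1
    · simp only [hG, hK, h1, if_false]
      have h3 := hx s (not_le.mp h1).le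
      have h4 : Real.exp (-(1 / (c ^ 2 * s))) ≤ 1 := by
        rw [Real.exp_le_one_iff, neg_nonpos]; positivity
      calc _ ≤ s ^ (-a) * 1 * (D * s ^ (-γ) * f (r ^ 2)) := by gcongr
        _ = _ := by rw [sub_eq_add_neg, Real.rpow_add hs]; ring
  have hGmeas : AEStronglyMeasurable G (volume.restrict (Ioi 0)) := by
    have hA : AEMeasurable (fun s => f (r ^ 2 * s)) (volume.restrict (Ioi (0:ℝ))) := by
      refine aemeasurable_restrict_of_antitoneOn measurableSet_Ioi fun x hx y hy hxy => ?_
      have : 0 < x := hx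
      exact hmono _ _ (by positivity) (by gcongr)
    have hB : Measurable fun s : ℝ => s ^ (-a) * Real.exp (-(1 / (c ^ 2 * s))) := by fun_prop
    exact (hB.aemeasurable.mul hA).aestronglyMeasurable
  have hGint : IntegrableOn G (Ioi 0) := by
    refine Integrable.mono' (hKint.mul_const (f (r ^ 2))) hGmeas ?_
    filter_upwards [ae_restrict_mem measurableSet_Ioi] with s hs
    rw [Real.norm_of_nonneg (hGnn s hs)]
    exact hGK s hs
  have hrp : 0 < r ^ (-2 * a + 2) := by positivity
  rw [hsub]
  constructor
  · have : c₁ * f (r ^ 2) ≤ ∫ s in Ioi (0:ℝ), G s := by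
      calc c₁ * f (r ^ 2) = ∫ s in Ioc (1:ℝ) 2, c₁ * f (r ^ 2) := by
            simp; norm_num
        _ ≤ ∫ s in Ioc (1:ℝ) 2, G s := by
            have hci : IntegrableOn (fun _ : ℝ => c₁ * f (r ^ 2)) (Ioc (1:ℝ) 2) := integrableOn_const (by simp)
            refine setIntegral_mono_on hci
              (hGint.mono_set fun x hx => lt_trans one_pos hx.1) measurableSet_Ioc ?_
            intro s hs
            obtain ⟨h1, h2⟩ := hs
            have hs : 0 < s := by linarith
            have k1 := hmono2 (r ^ 2) (r ^ 2 * 2) hr2 (by nlinarith)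
            have k2 : f (r ^ 2 * 2) ≤ f (r ^ 2 * s) := hmono _ _ (by positivity) (by gcongr)
            have k3 : 1 / 4 * f (r ^ 2) ≤ f (r ^ 2 * s) := by
              refine le_trans ?_ k2
              refine le_of_mul_le_mul_left ?_ (show 0 < (r ^ 2) ^ 2 by positivity)
              linarith
            have k4 : (2:ℝ) ^ (-a) ≤ s ^ (-a) :=
              Real.rpow_le_rpow_of_nonpos hs h2 (by linarith)
            have k5 : Real.exp (-(1 / c ^ 2)) ≤ Real.exp (-(1 / (c ^ 2 * s))) := by
              have : c ^ 2 ≤ c ^ 2 * s := le_mul_of_one_le_right (by positivity) h1.le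
              gcongr
            simp only [hG, hc₁]
            rw [mul_assoc _ (1 / 4 : ℝ)]
            gcongr
        _ ≤ _ := by
            refine setIntegral_mono_set hGint ?_ ?_
            · filter_upwards [ae_restrict_mem measurableSet_Ioi] with s hs using hGnn s hs
            · exact LE.le.eventuallyLE fun x hx => lt_trans one_pos hx.1
    calc _ = r ^ (-2 * a + 2) * (c₁ * f (r ^ 2)) := by ring
      _ ≤ _ := by gcongr
  · have : ∫ s in Ioi (0:ℝ), G s ≤ (∫ s in Ioi (0:ℝ), K s) * f (r ^ 2) := by
      rw [← integral_mul_const]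
      exact setIntegral_mono_on hGint (hKint.mul_const _) measurableSet_Ioi hGK
    calc _ ≤ r ^ (-2 * a + 2) * ((∫ s in Ioi (0:ℝ), K s) * f (r ^ 2)) := by gcongr
      _ = (∫ s in Ioi (0:ℝ), K s) * (r ^ (-2 * a + 2) * f (r ^ 2)) := by ring
      _ ≤ _ := by gcongr; exact le_max_right _ _

/-- Lemma A.2: for `a ≥ 0`, `c > 0` and a non-increasing `f : (0,∞) → (0,∞)` with
`t ↦ t² f(t)` non-decreasing, the function `F(r) = ∫_0^∞ t^{-a} e^{-r²/(c²t)} f(t) dt`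
satisfies `F(r) ≍ r^{-2a+2} f(r²)` for `r > R₀`, where `R₀ = 0` if `a > 1`, and
`R₀ = √R` if `a ≤ 1`, assuming in the latter case that `f(tx)/f(t) ≤ c' x^{-γ'}`
for all `t > R`, `x ≥ 1`, for some `c' > 0` and `γ' > 1 - a`. -/
theorem stmt_19 (a c R R₀ c' γ' : ℝ) (f F : ℝ → ℝ)
    (ha : 0 ≤ a) (hc : 0 < c)
    (hfpos : ∀ t : ℝ, 0 < t → 0 < f t)
    (hmono : ∀ s t : ℝ, 0 < s → s ≤ t → f t ≤ f s)
    (hmono2 : ∀ s t : ℝ, 0 < s → s ≤ t → s ^ 2 * f s ≤ t ^ 2 * f t)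
    (hcase : (1 < a ∧ R₀ = 0) ∨
      (a ≤ 1 ∧ 0 ≤ R ∧ R₀ = Real.sqrt R ∧ 0 < c' ∧ 1 - a < γ' ∧
        ∀ t x : ℝ, R < t → 1 ≤ x → f (t * x) / f t ≤ c' * x ^ (-γ')))
    (hF : ∀ r : ℝ, 0 < r → F r = ∫ t in Set.Ioi (0:ℝ),
      t ^ (-a) * Real.exp (-(r ^ 2 / (c ^ 2 * t))) * f t) :
    ∃ c₁ c₂ : ℝ, 0 < c₁ ∧ c₁ ≤ c₂ ∧ ∀ r : ℝ, R₀ < r →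
      c₁ * (r ^ (-2 * a + 2) * f (r ^ 2)) ≤ F r ∧
      F r ≤ c₂ * (r ^ (-2 * a + 2) * f (r ^ 2)) := by
  rcases hcase with ⟨h1, rfl⟩ | ⟨h1, hR, rfl, hc', hγ, hx⟩
  · obtain ⟨c₁, c₂, h, h', H⟩ := aux_main_s19 a c 1 0 f ha hc one_pos (by linarith) hfpos hmono hmono2
    refine ⟨c₁, c₂, h, h', fun r hr => ?_⟩
    rw [hF r hr]
    refine H r hr fun x hx => ?_
    have := hmono (r ^ 2) (r ^ 2 * x) (by positivity) (le_mul_of_one_le_right (by positivity) hx)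
    simpa using this
  · obtain ⟨c₁, c₂, h, h', H⟩ := aux_main_s19 a c c' γ' f ha hc hc' hγ hfpos hmono hmono2
    refine ⟨c₁, c₂, h, h', fun r hr => ?_⟩
    have hr0 : 0 < r := lt_of_le_of_lt (Real.sqrt_nonneg R) hr
    rw [hF r hr0]
    refine H r hr0 fun x hx1 => ?_
    have := hx (r ^ 2) x ((Real.sqrt_lt' hr0).mp hr) hx1
    rwa [div_le_iff₀ (hfpos _ (by positivity))] at this
end
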